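/- arXiv:1712.03319 — 3 statements merged into one kernel-verified Lean document; each statement's English description precedes it below -/
import Mathlib

section
/- Let α, β > 0 and let a, b : (0,∞) → (0,∞) be regularly varying of indices 1/α and 1/β respectively, with a(t) → ∞ and b(t) → ∞ as t → ∞. Let ν be a Borel measure on [0,∞)² with ν((p,∞)×(q,∞)) < ∞ for all p, q ≥ 0 with p + q > 0. Suppose that for every (p,q) ∈ [0,∞)² with (p,q) ≠ (0,0) and ν(∂((p,∞)×(q,∞))) = 0, one has t·P(W⁺ > p·a(t), W⁻ > q·b(t)) → ν((p,∞)×(q,∞)) as t → ∞. Then for every such (p,q), t·P(Z⁺ > p·a(t), Z⁻ > q·b(t)) → ν((p,∞)×(q,∞)) as t → ∞; that is, the mixed Poisson pair (Z⁺, Z⁻) inherits the non-standard regular variation of its mixing pair (W⁺, W⁻), with the same scaling functions and the same limit measure. -/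
open MeasureTheory ProbabilityTheory Filter Set

/-- growth of a regularly varying function -/
lemma mp_growth (α : ℝ) (hα : 0 < α) (a : ℝ → ℝ) (hapos : ∀ t, 0 < a t)
    (haRV : ∀ c : ℝ, 0 < c → Tendsto (fun t => a (c * t) / a t) atTop (nhds (c ^ (1 / α))))
    (hainf : Tendsto a atTop atTop) (κ : ℝ) (hκ : 0 < κ) :
    Tendsto (fun t => t * Real.exp (-(κ * a t))) atTop (nhds 0) := by
  have hg : (1:ℝ) < 2 ^ (1 / α) := Real.one_lt_rpow (by norm_num) (by positivity)
  obtain ⟨ρ, h1ρ, hρ⟩ := exists_between hg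
  have e1 := (haRV 2 (by norm_num)).eventually (lt_mem_nhds hρ)
  have e2 := hainf.eventually_ge_atTop (Real.log 4 / (κ * (ρ - 1)))
  obtain ⟨T, hT⟩ := eventually_atTop.1 ((e1.and e2).and (eventually_ge_atTop (1:ℝ)))
  have hT1 : 1 ≤ T := (hT T le_rfl).2
  have hstep : ∀ s, T ≤ s → (2 * s) ^ 2 * Real.exp (-(κ * a (2 * s))) ≤
      s ^ 2 * Real.exp (-(κ * a s)) := by
    intro s hs
    obtain ⟨⟨h1, h2⟩, h3⟩ := hT s hs
    have h4 : ρ * a s < a (2 * s) := by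
      rwa [lt_div_iff₀ (hapos s)] at h1
    have h5 : Real.log 4 ≤ a s * (κ * (ρ - 1)) := by
      rwa [div_le_iff₀ (mul_pos hκ (by linarith))] at h2
    have h6 : Real.log 4 + -(κ * a (2 * s)) ≤ -(κ * a s) := by
      nlinarith [mul_lt_mul_of_pos_left h4 hκ]
    have h7 := Real.exp_le_exp.2 h6
    rw [Real.exp_add, Real.exp_log (by norm_num)] at h7
    nlinarith [sq_nonneg s]
  have hb : ∀ n : ℕ, ∀ t, T ≤ t → t ≤ 2 ^ (n + 1) * T →
      t ^ 2 * Real.exp (-(κ * a t)) ≤ 4 * T ^ 2 := by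
    intro n
    have base : ∀ t, T ≤ t → t ≤ 2 * T → t ^ 2 * Real.exp (-(κ * a t)) ≤ 4 * T ^ 2 := by
      intro t h1 h2
      have : Real.exp (-(κ * a t)) ≤ 1 := by
        rw [Real.exp_le_one_iff]
        have := mul_pos hκ (hapos t)
        linarith
      have h3 : t ^ 2 ≤ 4 * T ^ 2 := by nlinarith
      nlinarith [sq_nonneg t, Real.exp_pos (-(κ * a t))]
    induction n with
    | zero => intro t h1 h2; exact base t h1 (by simpa using h2)
    | succ n ih =>
      intro t h1 h2
      by_cases h : t ≤ 2 * T
      · exact base t h1 h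
      · push Not at h
        have h3 := hstep (t / 2) (by linarith)
        have h4 := ih (t / 2) (by linarith) (by rw [pow_succ] at h2; linarith)
        rw [mul_div_cancel₀ t (by norm_num : (2:ℝ) ≠ 0)] at h3
        linarith
  have hlim : Tendsto (fun t : ℝ => 4 * T ^ 2 * t⁻¹) atTop (nhds 0) := by
    have h := (tendsto_inv_atTop_zero (𝕜 := ℝ)).const_mul (4 * T ^ 2)
    rw [mul_zero] at h
    exact h
  refine tendsto_of_tendsto_of_tendsto_of_le_of_le' tendsto_const_nhds hlim ?_ ?_
  · filter_upwards [eventually_ge_atTop T] with t ht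
    have : 0 ≤ t := by linarith
    positivity
  · filter_upwards [eventually_ge_atTop T] with t ht
    have h0 : 0 < t := by linarith
    obtain ⟨n, hn⟩ := pow_unbounded_of_one_lt t (by norm_num : (1:ℝ) < 2)
    have := hb n t ht (by
      rw [pow_succ]
      have : (0:ℝ) < 2 ^ n := by positivity
      nlinarith)
    rw [← div_eq_mul_inv, le_div_iff₀ h0]
    linarith

/-- the Poisson weight -/
noncomputable def mpPois (w : ℝ) (k : ℕ) : ℝ := Real.exp (-w) * w ^ k / (Nat.factorial k : ℝ)

lemma mpPois_nonneg {w : ℝ} (hw : 0 ≤ w) (k : ℕ) : 0 ≤ mpPois w k := by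
  unfold mpPois; positivity

lemma mpPois_hasSum (w s : ℝ) : HasSum (fun k => mpPois w k * s ^ k) (Real.exp (w * (s - 1))) := by
  have h : HasSum (fun k : ℕ => (w * s) ^ k / (Nat.factorial k : ℝ)) (Real.exp (w * s)) := by
    rw [Real.exp_eq_exp_ℝ]
    exact NormedSpace.expSeries_div_hasSum_exp (w * s)
  have h2 := h.mul_left (Real.exp (-w))
  rw [← Real.exp_add] at h2
  have e1 : (fun k => mpPois w k * s ^ k) =
      fun k : ℕ => Real.exp (-w) * ((w * s) ^ k / (Nat.factorial k : ℝ)) := by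
    funext k; unfold mpPois; rw [mul_pow]; ring
  have e2 : w * (s - 1) = -w + w * s := by ring
  rw [e1, e2]
  exact h2

lemma mpPois_le_one {w : ℝ} (hw : 0 ≤ w) (k : ℕ) : mpPois w k ≤ 1 := by
  have h := mpPois_hasSum w 1
  simp only [one_pow, mul_one, sub_self, mul_zero, Real.exp_zero] at h
  exact le_hasSum h k (fun i _ => mpPois_nonneg hw i)

lemma mpPois_measurable (k : ℕ) : Measurable (fun w => mpPois w k) := by
  unfold mpPois; fun_prop

lemma mpPois_tsum {w : ℝ} (hw : 0 ≤ w) {s : ℝ} (hs : 0 ≤ s) :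
    ∑' k, ENNReal.ofReal (mpPois w k * s ^ k) = ENNReal.ofReal (Real.exp (w * (s - 1))) := by
  have h := mpPois_hasSum w s
  rw [← h.tsum_eq, ENNReal.ofReal_tsum_of_nonneg _ h.summable]
  intro k
  exact mul_nonneg (mpPois_nonneg hw k) (pow_nonneg hs k)

lemma mp_marginal {Ω : Type*} [MeasurableSpace Ω] (P : Measure Ω) [IsProbabilityMeasure P]
    (V W : Ω → ℝ) (hV : Measurable V) (hW : Measurable W) (hV0 : ∀ ω, 0 ≤ V ω)
    (hW0 : ∀ ω, 0 ≤ W ω) (X Y : Ω → ℕ) (hX : Measurable X) (hY : Measurable Y)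
    (hmix : ∀ (k l : ℕ) (A : Set ℝ), MeasurableSet A →
      (P {ω | X ω = k ∧ Y ω = l ∧ V ω ∈ A}).toReal =
        ∫ ω, Set.indicator A (fun _ => (1 : ℝ)) (V ω) * mpPois (V ω) k * mpPois (W ω) l ∂P)
    (k : ℕ) (A : Set ℝ) (hA : MeasurableSet A) :
    P {ω | X ω = k ∧ V ω ∈ A} = ∫⁻ ω in V ⁻¹' A, ENNReal.ofReal (mpPois (V ω) k) ∂P := by
  have hVA : MeasurableSet (V ⁻¹' A) := hV hA
  have m1 : ∀ j, Measurable (fun ω => mpPois (V ω) j) := fun j => (mpPois_measurable j).comp hV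
  have m2 : ∀ j, Measurable (fun ω => mpPois (W ω) j) := fun j => (mpPois_measurable j).comp hW
  have key : ∀ l, P {ω | X ω = k ∧ Y ω = l ∧ V ω ∈ A} =
      ∫⁻ ω in V ⁻¹' A, ENNReal.ofReal (mpPois (V ω) k) * ENNReal.ofReal (mpPois (W ω) l) ∂P := by
    intro l
    rw [← ENNReal.ofReal_toReal (measure_ne_top P {ω | X ω = k ∧ Y ω = l ∧ V ω ∈ A}),
      hmix k l A hA]
    have e : (fun ω => Set.indicator A (fun _ => (1 : ℝ)) (V ω) * mpPois (V ω) k * mpPois (W ω) l)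
        = Set.indicator (V ⁻¹' A) (fun ω => mpPois (V ω) k * mpPois (W ω) l) := by
      funext ω
      by_cases h : V ω ∈ A <;> simp [Set.indicator, h]
    rw [e, integral_indicator hVA, ofReal_integral_eq_lintegral_ofReal]
    · apply lintegral_congr
      intro ω
      exact ENNReal.ofReal_mul (mpPois_nonneg (hV0 ω) k)
    · apply Integrable.of_bound (C := 1)
      · exact ((m1 k).mul (m2 l)).aestronglyMeasurable
      · refine Eventually.of_forall fun ω => ?_
        rw [Real.norm_of_nonneg (mul_nonneg (mpPois_nonneg (hV0 ω) k) (mpPois_nonneg (hW0 ω) l))]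
        exact mul_le_one₀ (mpPois_le_one (hV0 ω) k) (mpPois_nonneg (hW0 ω) l)
          (mpPois_le_one (hW0 ω) l)
    · exact Eventually.of_forall fun ω =>
        mul_nonneg (mpPois_nonneg (hV0 ω) k) (mpPois_nonneg (hW0 ω) l)
  have hU : {ω | X ω = k ∧ V ω ∈ A} = ⋃ l, {ω | X ω = k ∧ Y ω = l ∧ V ω ∈ A} := by
    ext ω; simp
  rw [hU, measure_iUnion]
  · simp_rw [key]
    rw [← lintegral_tsum]
    · apply lintegral_congr
      intro ω
      rw [ENNReal.tsum_mul_left]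
      have := mpPois_tsum (hW0 ω) zero_le_one
      simp only [one_pow, mul_one, sub_self, mul_zero, Real.exp_zero, ENNReal.ofReal_one] at this
      rw [this, mul_one]
    · intro l
      exact ((m1 k).ennreal_ofReal.mul (m2 l).ennreal_ofReal).aemeasurable
  · intro i j hij
    refine Set.disjoint_left.2 ?_
    rintro ω ⟨_, h1, _⟩ ⟨_, h2, _⟩
    exact hij (h1.symm.trans h2)
  · intro l
    exact (hX (measurableSet_singleton k)).inter ((hY (measurableSet_singleton l)).inter hVA)

lemma mp_chernoff {Ω : Type*} [MeasurableSpace Ω] (P : Measure Ω) [IsProbabilityMeasure P]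
    (V : Ω → ℝ) (hV : Measurable V) (hV0 : ∀ ω, 0 ≤ V ω) (X : Ω → ℕ)
    (hmarg : ∀ (k : ℕ) (A : Set ℝ), MeasurableSet A →
      P {ω | X ω = k ∧ V ω ∈ A} = ∫⁻ ω in V ⁻¹' A, ENNReal.ofReal (mpPois (V ω) k) ∂P)
    (S : Set ℕ) (A : Set ℝ) (hA : MeasurableSet A) (s D C : ℝ) (hs : 0 < s) (hD : 0 ≤ D)
    (hC : 0 ≤ C)
    (hS : ∀ k ∈ S, 1 ≤ D * s ^ k) (hAC : ∀ w ∈ A, D * Real.exp (w * (s - 1)) ≤ C) :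
    (P {ω | X ω ∈ S ∧ V ω ∈ A}).toReal ≤ C := by
  have hVA : MeasurableSet (V ⁻¹' A) := hV hA
  apply ENNReal.toReal_le_of_le_ofReal hC
  have hU : {ω | X ω ∈ S ∧ V ω ∈ A} = ⋃ k, {ω | X ω ∈ S ∧ X ω = k ∧ V ω ∈ A} := by
    ext ω; simp
  calc P {ω | X ω ∈ S ∧ V ω ∈ A}
      ≤ ∑' k, P {ω | X ω ∈ S ∧ X ω = k ∧ V ω ∈ A} := by
        rw [hU]; exact measure_iUnion_le _
    _ ≤ ∑' k, ∫⁻ ω in V ⁻¹' A, ENNReal.ofReal D * ENNReal.ofReal (mpPois (V ω) k * s ^ k) ∂P := by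
        refine ENNReal.tsum_le_tsum fun k => ?_
        by_cases hk : k ∈ S
        · refine (measure_mono (t := {ω | X ω = k ∧ V ω ∈ A}) (fun ω h => h.2)).trans ?_
          rw [hmarg k A hA]
          refine lintegral_mono fun ω => ?_
          rw [← ENNReal.ofReal_mul hD]
          apply ENNReal.ofReal_le_ofReal
          nlinarith [mul_le_mul_of_nonneg_left (hS k hk) (mpPois_nonneg (hV0 ω) k)]
        · have : {ω | X ω ∈ S ∧ X ω = k ∧ V ω ∈ A} = ∅ := by
            ext ω
            simp only [mem_setOf_eq, mem_empty_iff_false, iff_false]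
            rintro ⟨h1, h2, _⟩
            exact hk (h2 ▸ h1)
          rw [this]; simp
    _ = ∫⁻ ω in V ⁻¹' A, ENNReal.ofReal (D * Real.exp (V ω * (s - 1))) ∂P := by
        rw [← lintegral_tsum]
        · apply lintegral_congr
          intro ω
          rw [ENNReal.tsum_mul_left, mpPois_tsum (hV0 ω) hs.le, ENNReal.ofReal_mul hD]
        · intro k
          have : Measurable (fun ω => mpPois (V ω) k) := (mpPois_measurable k).comp hV
          exact ((this.mul_const _).ennreal_ofReal.const_mul _).aemeasurable
    _ ≤ ∫⁻ ω in V ⁻¹' A, ENNReal.ofReal C ∂P := by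
        refine setLIntegral_mono' hVA fun ω hω => ?_
        exact ENNReal.ofReal_le_ofReal (hAC _ hω)
    _ ≤ ENNReal.ofReal C := by
        rw [setLIntegral_const]
        calc _ ≤ ENNReal.ofReal C * 1 := by gcongr; exact prob_le_one
          _ = _ := mul_one _

lemma mp_kappa {r : ℝ} (hr : 0 < r) (hr1 : r ≠ 1) : 0 < Real.log r - 1 + 1 / r := by
  have h := Real.log_lt_sub_one_of_pos (inv_pos.2 hr) (by simpa using hr1)
  rw [Real.log_inv] at h
  rw [one_div]; linarith

lemma mp_upper_tail {Ω : Type*} [MeasurableSpace Ω] (P : Measure Ω) [IsProbabilityMeasure P]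
    (V : Ω → ℝ) (hV : Measurable V) (hV0 : ∀ ω, 0 ≤ V ω) (X : Ω → ℕ)
    (hmarg : ∀ (k : ℕ) (A : Set ℝ), MeasurableSet A →
      P {ω | X ω = k ∧ V ω ∈ A} = ∫⁻ ω in V ⁻¹' A, ENNReal.ofReal (mpPois (V ω) k) ∂P)
    (x r : ℝ) (hr : 1 < r) :
    (P {ω | x < (X ω : ℝ) ∧ V ω ≤ x / r}).toReal ≤
      Real.exp (-((Real.log r - 1 + 1 / r) * x)) := by
  have hr0 : 0 < r := by linarith
  refine mp_chernoff P V hV hV0 X hmarg {k | x < (k:ℝ)} (Iic (x / r)) measurableSet_Iic r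
    (Real.exp (-(x * Real.log r))) _ hr0 (Real.exp_pos _).le (Real.exp_pos _).le ?_ ?_
  · intro k hk
    have hk : x < (k:ℝ) := hk
    have : r ^ k = Real.exp (k * Real.log r) := by
      rw [Real.exp_nat_mul, Real.exp_log hr0]
    rw [this, ← Real.exp_add]
    apply Real.one_le_exp
    nlinarith [Real.log_pos hr]
  · intro w hw
    have hw : w ≤ x / r := hw
    rw [← Real.exp_add]
    apply Real.exp_le_exp.2
    have h1 : w * (r - 1) ≤ x / r * (r - 1) := mul_le_mul_of_nonneg_right hw (by linarith)
    have h2 : x / r * (r - 1) = x - x * (1 / r) := by field_simp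
    nlinarith

lemma mp_lower_tail {Ω : Type*} [MeasurableSpace Ω] (P : Measure Ω) [IsProbabilityMeasure P]
    (V : Ω → ℝ) (hV : Measurable V) (hV0 : ∀ ω, 0 ≤ V ω) (X : Ω → ℕ)
    (hmarg : ∀ (k : ℕ) (A : Set ℝ), MeasurableSet A →
      P {ω | X ω = k ∧ V ω ∈ A} = ∫⁻ ω in V ⁻¹' A, ENNReal.ofReal (mpPois (V ω) k) ∂P)
    (x r : ℝ) (hr0 : 0 < r) (hr : r < 1) :
    (P {ω | (X ω : ℝ) ≤ x ∧ x / r < V ω}).toReal ≤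
      Real.exp (-((Real.log r - 1 + 1 / r) * x)) := by
  refine mp_chernoff P V hV hV0 X hmarg {k | (k:ℝ) ≤ x} (Ioi (x / r)) measurableSet_Ioi r
    (Real.exp (-(x * Real.log r))) _ hr0 (Real.exp_pos _).le (Real.exp_pos _).le ?_ ?_
  · intro k hk
    have hk : (k:ℝ) ≤ x := hk
    have : r ^ k = Real.exp (k * Real.log r) := by
      rw [Real.exp_nat_mul, Real.exp_log hr0]
    rw [this, ← Real.exp_add]
    apply Real.one_le_exp
    nlinarith [Real.log_neg hr0 hr]
  · intro w hw
    have hw : x / r < w := hw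
    rw [← Real.exp_add]
    apply Real.exp_le_exp.2
    have h1 : w * (r - 1) ≤ x / r * (r - 1) := mul_le_mul_of_nonpos_right hw.le (by linarith)
    have h2 : x / r * (r - 1) = x - x * (1 / r) := by field_simp
    nlinarith

lemma mp_zero {Ω : Type*} [MeasurableSpace Ω] (P : Measure Ω) [IsProbabilityMeasure P]
    (V : Ω → ℝ) (hV : Measurable V) (hV0 : ∀ ω, 0 ≤ V ω) (X : Ω → ℕ)
    (hmarg : ∀ (k : ℕ) (A : Set ℝ), MeasurableSet A →
      P {ω | X ω = k ∧ V ω ∈ A} = ∫⁻ ω in V ⁻¹' A, ENNReal.ofReal (mpPois (V ω) k) ∂P) :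
    (P {ω | 0 < (X ω : ℝ) ∧ V ω ≤ 0}).toReal = 0 := by
  apply le_antisymm _ ENNReal.toReal_nonneg
  apply le_of_forall_pos_le_add
  intro ε hε
  rw [zero_add]
  -- use s = max 1 (1/ε)
  have hs1 : 1 ≤ 1 + 1 / ε := by have : 0 < 1 / ε := by positivity
                                 linarith
  have hs0 : 0 < 1 + 1 / ε := by linarith
  refine mp_chernoff P V hV hV0 X hmarg {k | 0 < (k:ℝ)} (Iic 0) measurableSet_Iic (1 + 1 / ε)
    ((1 + 1 / ε)⁻¹) ε hs0 (inv_nonneg.2 hs0.le) hε.le ?_ ?_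
  · intro k hk
    have hk : 0 < (k:ℝ) := hk
    have hk' : k ≠ 0 := by rintro rfl; simp at hk
    rw [inv_mul_eq_div, one_le_div hs0]
    exact le_self_pow₀ hs1 hk'
  · intro w hw
    have hw : w ≤ 0 := hw
    have h1 : Real.exp (w * (1 + 1 / ε - 1)) ≤ 1 := by
      rw [Real.exp_le_one_iff]
      exact mul_nonpos_of_nonpos_of_nonneg hw (by linarith)
    have h2 : (1 + 1 / ε)⁻¹ ≤ ε := by
      rw [inv_le_comm₀ hs0 hε, inv_eq_one_div]; linarith
    calc _ ≤ (1 + 1 / ε)⁻¹ * 1 := mul_le_mul_of_nonneg_left h1 (inv_nonneg.2 hs0.le)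
      _ ≤ ε := by rwa [mul_one]

lemma mp_err_upper {Ω : Type*} [MeasurableSpace Ω] (P : Measure Ω) [IsProbabilityMeasure P]
    (V : Ω → ℝ) (hV : Measurable V) (hV0 : ∀ ω, 0 ≤ V ω) (X : Ω → ℕ)
    (hmarg : ∀ (k : ℕ) (A : Set ℝ), MeasurableSet A →
      P {ω | X ω = k ∧ V ω ∈ A} = ∫⁻ ω in V ⁻¹' A, ENNReal.ofReal (mpPois (V ω) k) ∂P)
    (a : ℝ → ℝ)
    (hg : ∀ κ : ℝ, 0 < κ → Tendsto (fun t => t * Real.exp (-(κ * a t))) atTop (nhds 0))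
    (p : ℝ) (hp : 0 ≤ p) (r : ℝ) (hr : 1 < r) :
    Tendsto (fun t => t * (P {ω | p * a t < (X ω : ℝ) ∧ V ω ≤ p * a t / r}).toReal) atTop
      (nhds 0) := by
  rcases hp.eq_or_lt with rfl | hp
  · have := mp_zero P V hV hV0 X hmarg
    simp only [zero_mul, zero_div, this, mul_zero]
    exact tendsto_const_nhds
  · have hκ := mp_kappa (by linarith : 0 < r) hr.ne'
    refine tendsto_of_tendsto_of_tendsto_of_le_of_le' tendsto_const_nhds (hg _ (mul_pos hκ hp)) ?_ ?_
    · filter_upwards [eventually_ge_atTop 0] with t ht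
      exact mul_nonneg ht ENNReal.toReal_nonneg
    · filter_upwards [eventually_ge_atTop 0] with t ht
      refine mul_le_mul_of_nonneg_left ?_ ht
      rw [mul_assoc]
      exact mp_upper_tail P V hV hV0 X hmarg _ r hr

lemma mp_err_lower {Ω : Type*} [MeasurableSpace Ω] (P : Measure Ω) [IsProbabilityMeasure P]
    (V : Ω → ℝ) (hV : Measurable V) (hV0 : ∀ ω, 0 ≤ V ω) (X : Ω → ℕ)
    (hmarg : ∀ (k : ℕ) (A : Set ℝ), MeasurableSet A →
      P {ω | X ω = k ∧ V ω ∈ A} = ∫⁻ ω in V ⁻¹' A, ENNReal.ofReal (mpPois (V ω) k) ∂P)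
    (a : ℝ → ℝ)
    (hg : ∀ κ : ℝ, 0 < κ → Tendsto (fun t => t * Real.exp (-(κ * a t))) atTop (nhds 0))
    (p : ℝ) (hp : 0 < p) (r : ℝ) (hr0 : 0 < r) (hr : r < 1) :
    Tendsto (fun t => t * (P {ω | (X ω : ℝ) ≤ p * a t ∧ p * a t / r < V ω}).toReal) atTop
      (nhds 0) := by
  have hκ := mp_kappa hr0 hr.ne
  refine tendsto_of_tendsto_of_tendsto_of_le_of_le' tendsto_const_nhds (hg _ (mul_pos hκ hp)) ?_ ?_
  · filter_upwards [eventually_ge_atTop 0] with t ht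
    exact mul_nonneg ht ENNReal.toReal_nonneg
  · filter_upwards [eventually_ge_atTop 0] with t ht
    refine mul_le_mul_of_nonneg_left ?_ ht
    rw [mul_assoc]
    exact mp_lower_tail P V hV hV0 X hmarg _ r hr0 hr

lemma mp_union3 {Ω : Type*} [MeasurableSpace Ω] (P : Measure Ω) [IsProbabilityMeasure P]
    (A B C D : Set Ω) (h : A ⊆ B ∪ C ∪ D) :
    (P A).toReal ≤ (P B).toReal + (P C).toReal + (P D).toReal := by
  have h1 : P.real A ≤ P.real (B ∪ C ∪ D) := measureReal_mono h
  have h2 : P.real (B ∪ C ∪ D) ≤ P.real (B ∪ C) + P.real D := measureReal_union_le _ _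
  have h3 : P.real (B ∪ C) ≤ P.real B + P.real C := measureReal_union_le _ _
  simp only [Measure.real] at h1 h2 h3
  linarith

/-- rescaling time in the limit -/
lemma mp_rescale (F : ℝ → ℝ) (L c : ℝ) (hc : 0 < c)
    (h : Tendsto (fun t => t * F t) atTop (nhds L)) :
    Tendsto (fun t => t * F (c * t)) atTop (nhds (L / c)) := by
  have h1 := (h.comp (tendsto_id.const_mul_atTop hc)).div_const c
  refine h1.congr fun t => ?_
  simp only [Function.comp, id]
  field_simp

/-- choice of a continuity threshold -/
lemma mp_threshold (ν : Measure (ℝ × ℝ)) (f : ℝ × ℝ → ℝ) (hf : Measurable f) (S T : Set (ℝ × ℝ))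
    (hS : MeasurableSet S) (hT : MeasurableSet T) (hTS : T ⊆ S) (hfin : ν (S ∩ f ⁻¹' Ioi 0) ≠ ⊤)
    (u : ℝ) (hu : u < (ν (T ∩ f ⁻¹' Ioi 0)).toReal) :
    ∃ p, 0 < p ∧ ν (S ∩ f ⁻¹' {p}) = 0 ∧ u < (ν (T ∩ f ⁻¹' Ioi p)).toReal := by
  have hfinT : ν (T ∩ f ⁻¹' Ioi 0) ≠ ⊤ :=
    ne_top_of_le_ne_top hfin (measure_mono (inter_subset_inter_left _ hTS))
  have hmono : Monotone (fun n : ℕ => T ∩ f ⁻¹' Ioi (1 / ((n:ℝ) + 1))) := by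
    intro m n hmn x hx
    have hx2 : 1 / ((m:ℝ) + 1) < f x := hx.2
    refine ⟨hx.1, show 1 / ((n:ℝ) + 1) < f x from lt_of_le_of_lt ?_ hx2⟩
    exact one_div_le_one_div_of_le (by positivity) (by gcongr)
  have hUn : (⋃ n : ℕ, T ∩ f ⁻¹' Ioi (1 / ((n:ℝ) + 1))) = T ∩ f ⁻¹' Ioi 0 := by
    ext x
    simp only [mem_iUnion, mem_inter_iff, mem_preimage, mem_Ioi]
    constructor
    · rintro ⟨n, h1, h2⟩
      exact ⟨h1, lt_trans (by positivity) h2⟩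
    · rintro ⟨h1, h2⟩
      obtain ⟨n, hn⟩ := exists_nat_one_div_lt h2
      exact ⟨n, h1, hn⟩
  have hlim := tendsto_measure_iUnion_atTop (μ := ν) hmono
  rw [hUn] at hlim
  have hlim2 := (ENNReal.tendsto_toReal hfinT).comp hlim
  obtain ⟨n, hn⟩ := (hlim2.eventually (lt_mem_nhds hu)).exists
  simp only [Function.comp] at hn
  have hδ : (0:ℝ) < 1 / ((n:ℝ) + 1) := by positivity
  haveI : IsFiniteMeasure (ν.restrict (S ∩ f ⁻¹' Ioi 0)) := ⟨by
    rw [Measure.restrict_apply_univ]; exact hfin.lt_top⟩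
  have hcount : Set.Countable {t : ℝ | 0 < (ν.restrict (S ∩ f ⁻¹' Ioi 0)) {x | f x = t}} :=
    Measure.countable_meas_level_set_pos hf
  have hne : ¬ (Ioo 0 (1 / ((n:ℝ) + 1)) ⊆
      {t : ℝ | 0 < (ν.restrict (S ∩ f ⁻¹' Ioi 0)) {x | f x = t}}) := by
    intro hsub
    have h1 := hcount.mono hsub
    have h2 := h1.measure_zero volume
    rw [Real.volume_Ioo] at h2
    simp only [sub_zero, ENNReal.ofReal_eq_zero] at h2
    linarith
  obtain ⟨p, hp, hp2⟩ := Set.not_subset.1 hne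
  refine ⟨p, hp.1, ?_, hn.trans_le ?_⟩
  · simp only [mem_setOf_eq, not_lt, nonpos_iff_eq_zero] at hp2
    have hp2 : (ν.restrict (S ∩ f ⁻¹' Ioi 0)) (f ⁻¹' {p}) = 0 := hp2
    rw [Measure.restrict_apply (hf (measurableSet_singleton p))] at hp2
    refine measure_mono_null ?_ hp2
    rintro x ⟨h1, h2⟩
    have h2 : f x = p := h2
    refine ⟨h2, h1, ?_⟩
    change 0 < f x
    rw [h2]; exact hp.1
  · refine ENNReal.toReal_mono ?_ (measure_mono ?_)
    · refine ne_top_of_le_ne_top hfinT (measure_mono ?_)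
      rintro x ⟨h1, h2⟩
      exact ⟨h1, hp.1.trans h2⟩
    · rintro x ⟨h1, h2⟩
      exact ⟨h1, hp.2.trans h2⟩

lemma mp_frontier (p q : ℝ) :
    frontier (Ioi p ×ˢ Ioi q) = Ici p ×ˢ {q} ∪ {p} ×ˢ Ici q := by
  rw [frontier_prod_eq, closure_Ioi, closure_Ioi, frontier_Ioi, frontier_Ioi]

/-- **Theorem.** A mixed Poisson pair `(Z⁺, Z⁻)` inherits the non-standard regular variation of
its mixing pair `(W⁺, W⁻)`, with the same scaling functions `a, b` and the same limit measure
`ν`. -/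
theorem mixed_poisson_nonstandard_regular_variation
    {Ω : Type*} [MeasurableSpace Ω] (P : Measure Ω) [IsProbabilityMeasure P]
    -- the mixing pair
    (Wp Wm : Ω → ℝ) (hWpmeas : Measurable Wp) (hWmmeas : Measurable Wm)
    (hWp0 : ∀ ω, 0 ≤ Wp ω) (hWm0 : ∀ ω, 0 ≤ Wm ω)
    -- the mixed Poisson pair: conditionally on (W⁺,W⁻), independent Poissons with those means
    (Zp Zm : Ω → ℕ) (hZpmeas : Measurable Zp) (hZmmeas : Measurable Zm)
    (hmix : ∀ (k l : ℕ) (A : Set (ℝ × ℝ)), MeasurableSet A →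
      (P {ω | Zp ω = k ∧ Zm ω = l ∧ (Wp ω, Wm ω) ∈ A}).toReal =
        ∫ ω, Set.indicator A (fun _ => (1 : ℝ)) (Wp ω, Wm ω) *
          (Real.exp (-Wp ω) * Wp ω ^ k / (Nat.factorial k : ℝ)) *
          (Real.exp (-Wm ω) * Wm ω ^ l / (Nat.factorial l : ℝ)) ∂P)
    -- regularly varying scaling functions of indices 1/α and 1/β, tending to ∞
    (α β : ℝ) (hα : 0 < α) (hβ : 0 < β)
    (a b : ℝ → ℝ) (hapos : ∀ t, 0 < a t) (hbpos : ∀ t, 0 < b t)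
    (haRV : ∀ c : ℝ, 0 < c → Tendsto (fun t => a (c * t) / a t) atTop (nhds (c ^ (1 / α))))
    (hbRV : ∀ c : ℝ, 0 < c → Tendsto (fun t => b (c * t) / b t) atTop (nhds (c ^ (1 / β))))
    (hainf : Tendsto a atTop atTop) (hbinf : Tendsto b atTop atTop)
    -- the limit measure ν, finite on upper-right quadrants
    (ν : Measure (ℝ × ℝ))
    (hνfin : ∀ p q : ℝ, 0 ≤ p → 0 ≤ q → 0 < p + q → ν (Ioi p ×ˢ Ioi q) ≠ ⊤)
    -- non-standard regular variation of the mixing pair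
    (hW : ∀ p q : ℝ, 0 ≤ p → 0 ≤ q → (p, q) ≠ (0, 0) →
      ν (frontier (Ioi p ×ˢ Ioi q)) = 0 →
      Tendsto (fun t => t * (P {ω | p * a t < Wp ω ∧ q * b t < Wm ω}).toReal) atTop
        (nhds (ν (Ioi p ×ˢ Ioi q)).toReal)) :
    -- conclusion: the same non-standard regular variation for the mixed Poisson pair
    ∀ p q : ℝ, 0 ≤ p → 0 ≤ q → (p, q) ≠ (0, 0) →
      ν (frontier (Ioi p ×ˢ Ioi q)) = 0 →
      Tendsto (fun t => t * (P {ω | p * a t < (Zp ω : ℝ) ∧ q * b t < (Zm ω : ℝ)}).toReal) atTop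
        (nhds (ν (Ioi p ×ˢ Ioi q)).toReal) := by
  have hmargp : ∀ (k : ℕ) (A : Set ℝ), MeasurableSet A →
      P {ω | Zp ω = k ∧ Wp ω ∈ A} = ∫⁻ ω in Wp ⁻¹' A, ENNReal.ofReal (mpPois (Wp ω) k) ∂P := by
    refine mp_marginal P Wp Wm hWpmeas hWmmeas hWp0 hWm0 Zp Zm hZpmeas hZmmeas ?_
    intro k l A hA
    have := hmix k l (Prod.fst ⁻¹' A) (measurable_fst hA)
    exact this
  have hmargm : ∀ (k : ℕ) (A : Set ℝ), MeasurableSet A →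
      P {ω | Zm ω = k ∧ Wm ω ∈ A} = ∫⁻ ω in Wm ⁻¹' A, ENNReal.ofReal (mpPois (Wm ω) k) ∂P := by
    refine mp_marginal P Wm Wp hWmmeas hWpmeas hWm0 hWp0 Zm Zp hZmmeas hZpmeas ?_
    intro k l A hA
    have := hmix l k (Prod.snd ⁻¹' A) (measurable_snd hA)
    have e : {ω | Zm ω = k ∧ Zp ω = l ∧ Wm ω ∈ A} =
        {ω | Zp ω = l ∧ Zm ω = k ∧ (Wp ω, Wm ω) ∈ Prod.snd ⁻¹' A} := by
      ext ω; simp only [mem_setOf_eq, mem_preimage]; tauto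
    rw [e, this]
    refine integral_congr_ae (Eventually.of_forall fun ω => ?_)
    change A.indicator (fun _ => (1:ℝ)) (Wm ω) * mpPois (Wp ω) l * mpPois (Wm ω) k = _
    ring
  have hga := mp_growth α hα a hapos haRV hainf
  have hgb := mp_growth β hβ b hbpos hbRV hbinf
  -- upper bound
  have hupper : ∀ p q : ℝ, 0 ≤ p → 0 ≤ q → (p, q) ≠ (0, 0) →
      ν (frontier (Ioi p ×ˢ Ioi q)) = 0 → ∀ u, (ν (Ioi p ×ˢ Ioi q)).toReal < u →
      ∀ᶠ t in atTop,
        t * (P {ω | p * a t < (Zp ω : ℝ) ∧ q * b t < (Zm ω : ℝ)}).toReal < u := by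
    intro p q hp hq hpq hν u hu
    have hlim := hW p q hp hq hpq hν
    set L := (ν (Ioi p ×ˢ Ioi q)).toReal with hL
    have hL0 : 0 ≤ L := ENNReal.toReal_nonneg
    have hu0 : 0 < u := hL0.trans_lt hu
    obtain ⟨c, hc1, hc2⟩ := exists_between (show L / u < 1 from (div_lt_one hu0).2 hu)
    have hc0 : 0 < c := lt_of_le_of_lt (by positivity) hc1
    have hLc : L / c < u := by
      rw [div_lt_iff₀ hu0] at hc1
      rw [div_lt_iff₀ hc0]; linarith
    have hca : c ^ (1 / α) < 1 := Real.rpow_lt_one hc0.le hc2 (by positivity)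
    have hcb : c ^ (1 / β) < 1 := Real.rpow_lt_one hc0.le hc2 (by positivity)
    obtain ⟨d, hd1, hd2⟩ := exists_between (max_lt hca hcb)
    have hda := (le_max_left _ _).trans_lt hd1
    have hdb := (le_max_right _ _).trans_lt hd1
    have hd0 : 0 < d := (Real.rpow_pos_of_pos hc0 _).trans hda
    have hr : 1 < d⁻¹ := (one_lt_inv₀ hd0).2 hd2
    have hH := mp_rescale (fun t => (P {ω | p * a t < Wp ω ∧ q * b t < Wm ω}).toReal) L c hc0 hlim
    have he1 := mp_err_upper P Wp hWpmeas hWp0 Zp hmargp a hga p hp d⁻¹ hr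
    have he2 := mp_err_upper P Wm hWmmeas hWm0 Zm hmargm b hgb q hq d⁻¹ hr
    have hsum := (hH.add he1).add he2
    rw [add_zero, add_zero] at hsum
    filter_upwards [hsum.eventually (gt_mem_nhds hLc), eventually_ge_atTop 0,
      (haRV c hc0).eventually (gt_mem_nhds hda), (hbRV c hc0).eventually (gt_mem_nhds hdb)]
      with t h1 ht ha hb
    rw [div_lt_iff₀ (hapos t)] at ha
    rw [div_lt_iff₀ (hbpos t)] at hb
    refine lt_of_le_of_lt ?_ h1
    rw [← mul_add, ← mul_add]
    refine mul_le_mul_of_nonneg_left (mp_union3 P _ _ _ _ ?_) ht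
    rintro ω ⟨hz1, hz2⟩
    by_cases w1 : Wp ω ≤ p * a t / d⁻¹
    · exact Or.inl (Or.inr ⟨hz1, w1⟩)
    by_cases w2 : Wm ω ≤ q * b t / d⁻¹
    · exact Or.inr ⟨hz2, w2⟩
    refine Or.inl (Or.inl ?_)
    rw [div_inv_eq_mul, not_le] at w1 w2
    exact ⟨by nlinarith [mul_le_mul_of_nonneg_left ha.le hp],
      by nlinarith [mul_le_mul_of_nonneg_left hb.le hq]⟩
  -- lower bound in the interior
  have hlower : ∀ p q : ℝ, 0 < p → 0 < q →
      ν (frontier (Ioi p ×ˢ Ioi q)) = 0 → ∀ u, u < (ν (Ioi p ×ˢ Ioi q)).toReal →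
      ∀ᶠ t in atTop,
        u < t * (P {ω | p * a t < (Zp ω : ℝ) ∧ q * b t < (Zm ω : ℝ)}).toReal := by
    intro p q hp hq hν u hu
    have hlim := hW p q hp.le hq.le (by simp [hp.ne']) hν
    set L := (ν (Ioi p ×ˢ Ioi q)).toReal with hL
    have hL0 : 0 ≤ L := ENNReal.toReal_nonneg
    obtain ⟨c, hc1, hLc⟩ : ∃ c, 1 < c ∧ u < L / c := by
      have : Tendsto (fun c : ℝ => L / c) (nhdsWithin 1 (Ioi 1)) (nhds (L / 1)) :=
        (tendsto_const_nhds.div tendsto_id one_ne_zero).mono_left nhdsWithin_le_nhds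
      rw [div_one] at this
      obtain ⟨c, h1, h2⟩ := ((this.eventually (lt_mem_nhds hu)).and self_mem_nhdsWithin).exists
      exact ⟨c, h2, h1⟩
    have hc0 : 0 < c := by linarith
    have hca : 1 < c ^ (1 / α) := Real.one_lt_rpow hc1 (by positivity)
    have hcb : 1 < c ^ (1 / β) := Real.one_lt_rpow hc1 (by positivity)
    obtain ⟨d, hd1, hd2⟩ := exists_between (lt_min hca hcb)
    have hda := hd2.trans_le (min_le_left _ _)
    have hdb := hd2.trans_le (min_le_right _ _)
    have hd0 : 0 < d := by linarith
    have hr0 : 0 < d⁻¹ := inv_pos.2 hd0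
    have hr : d⁻¹ < 1 := inv_lt_one_of_one_lt₀ hd1
    have hH := mp_rescale (fun t => (P {ω | p * a t < Wp ω ∧ q * b t < Wm ω}).toReal) L c hc0 hlim
    have he1 := mp_err_lower P Wp hWpmeas hWp0 Zp hmargp a hga p hp d⁻¹ hr0 hr
    have he2 := mp_err_lower P Wm hWmmeas hWm0 Zm hmargm b hgb q hq d⁻¹ hr0 hr
    have hsum := (hH.sub he1).sub he2
    rw [sub_zero, sub_zero] at hsum
    filter_upwards [hsum.eventually (lt_mem_nhds hLc), eventually_ge_atTop 0,
      (haRV c hc0).eventually (lt_mem_nhds hda), (hbRV c hc0).eventually (lt_mem_nhds hdb)]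
      with t h1 ht ha hb
    rw [lt_div_iff₀ (hapos t)] at ha
    rw [lt_div_iff₀ (hbpos t)] at hb
    refine lt_of_lt_of_le h1 ?_
    rw [sub_le_iff_le_add, sub_le_iff_le_add, ← mul_add, ← mul_add]
    refine mul_le_mul_of_nonneg_left ?_ ht
    rw [add_right_comm]
    refine mp_union3 P _ _ _ _ ?_
    rintro ω ⟨hz1, hz2⟩
    have w1 : p * a t / d⁻¹ < Wp ω := by
      rw [div_inv_eq_mul]; nlinarith [mul_le_mul_of_nonneg_left ha.le hp.le]
    have w2 : q * b t / d⁻¹ < Wm ω := by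
      rw [div_inv_eq_mul]; nlinarith [mul_le_mul_of_nonneg_left hb.le hq.le]
    by_cases z1 : (Zp ω : ℝ) ≤ p * a t
    · first
        | exact Or.inr ⟨z1, w1⟩
        | exact Or.inl (Or.inr ⟨z1, w1⟩)
    by_cases z2 : (Zm ω : ℝ) ≤ q * b t
    · first
        | exact Or.inr ⟨z2, w2⟩
        | exact Or.inl (Or.inr ⟨z2, w2⟩)
    exact Or.inl (Or.inl ⟨not_le.1 z1, not_le.1 z2⟩)
  intro p q hp hq hpq hν
  refine tendsto_order.2 ⟨?_, hupper p q hp hq hpq hν⟩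
  intro u hu
  have hν' := hν
  rw [mp_frontier, measure_union_null_iff] at hν'
  rcases hp.eq_or_lt with rfl | hp
  · have hq : 0 < q := lt_of_le_of_ne hq (by rintro rfl; exact hpq rfl)
    obtain ⟨p, hp, h1, h2⟩ := mp_threshold ν Prod.fst measurable_fst (Prod.snd ⁻¹' Ioi (q / 2))
      (Prod.snd ⁻¹' Ioi q) (measurable_snd measurableSet_Ioi) (measurable_snd measurableSet_Ioi)
      (preimage_mono (Ioi_subset_Ioi (by linarith)))
      (by
        have := hνfin 0 (q / 2) le_rfl (by linarith) (by linarith)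
        rwa [Set.prod_eq, inter_comm] at this) u
      (by rwa [Set.prod_eq, inter_comm] at hu)
    have hfr : ν (frontier (Ioi p ×ˢ Ioi q)) = 0 := by
      rw [mp_frontier, measure_union_null_iff]
      constructor
      · exact measure_mono_null (prod_mono_left (Ici_subset_Ici.2 hp.le)) hν'.1
      · refine measure_mono_null ?_ h1
        rintro ⟨x, y⟩ ⟨hx, hy⟩
        have hy : q ≤ y := hy
        exact ⟨show q / 2 < y by linarith, hx⟩
    rw [inter_comm, ← Set.prod_eq] at h2
    filter_upwards [hlower p q hp hq hfr u h2, eventually_ge_atTop 0] with t h3 ht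
    refine h3.trans_le (mul_le_mul_of_nonneg_left ?_ ht)
    refine ENNReal.toReal_mono (measure_ne_top _ _) (measure_mono ?_)
    rintro ω ⟨z1, z2⟩
    refine ⟨?_, z2⟩
    rw [zero_mul]
    exact (mul_pos hp (hapos t)).trans z1
  · rcases hq.eq_or_lt with rfl | hq
    · obtain ⟨q, hq, h1, h2⟩ := mp_threshold ν Prod.snd measurable_snd (Prod.fst ⁻¹' Ioi (p / 2))
        (Prod.fst ⁻¹' Ioi p) (measurable_fst measurableSet_Ioi) (measurable_fst measurableSet_Ioi)
        (preimage_mono (Ioi_subset_Ioi (by linarith)))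
        (by
          have := hνfin (p / 2) 0 (by linarith) le_rfl (by linarith)
          rwa [Set.prod_eq] at this) u
        (by rwa [Set.prod_eq] at hu)
      have hfr : ν (frontier (Ioi p ×ˢ Ioi q)) = 0 := by
        rw [mp_frontier, measure_union_null_iff]
        constructor
        · refine measure_mono_null ?_ h1
          rintro ⟨x, y⟩ ⟨hx, hy⟩
          have hx : p ≤ x := hx
          exact ⟨show p / 2 < x by linarith, hy⟩
        · exact measure_mono_null (prod_mono_right (Ici_subset_Ici.2 hq.le)) hν'.2
      rw [← Set.prod_eq] at h2
      filter_upwards [hlower p q hp hq hfr u h2, eventually_ge_atTop 0] with t h3 ht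
      refine h3.trans_le (mul_le_mul_of_nonneg_left ?_ ht)
      refine ENNReal.toReal_mono (measure_ne_top _ _) (measure_mono ?_)
      rintro ω ⟨z1, z2⟩
      refine ⟨z1, ?_⟩
      rw [zero_mul]
      exact (mul_pos hq (hbpos t)).trans z2
    · exact hlower p q hp hq hν u hu
end

section
/- Let κ̃ be a regular finitary, quasi-irreducible kernel on (S, μ). Then there exist r ≥ 0 and nonnegative, non-zero functions f₊, f₋ ∈ L²(μ) such that T_{κ̃}⁺ f₊ = r·f₊ and T_{κ̃}⁻ f₋ = r·f₋, where r is the common spectral radius of T_{κ̃}⁺ and T_{κ̃}⁻. Moreover, these eigenfunctions are unique up to positive multiplicative constants and μ-null sets among nonnegative eigenfunctions with positive eigenvalue: if g ∈ L²(μ) is nonnegative and non-zero with T_{κ̃}⁺ g = λ·g for some λ > 0, then λ = r and g = c·f₊ μ-a.e. for some constant c > 0, and the analogous uniqueness holds for T_{κ̃}⁻ and f₋. -/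
open MeasureTheory

section KernelDefs

variable {S : Type*} [MeasurableSpace S] [TopologicalSpace S]

/-- A kernel is *regular finitary* if `S` admits a finite partition into μ-continuity sets
`J_1, …, J_r` such that the kernel is constant on each `J_i × J_j`. -/
def RegularFinitary (μ : Measure S) (κ : S → S → ℝ) : Prop :=
  ∃ (r : ℕ) (J : Fin r → Set S),
    (∀ i, MeasurableSet (J i)) ∧ (∀ i, μ (frontier (J i)) = 0) ∧
    (Pairwise fun i j => Disjoint (J i) (J j)) ∧ (⋃ i, J i) = Set.univ ∧
    ∀ (i j : Fin r), ∀ x ∈ J i, ∀ y ∈ J j, ∀ x' ∈ J i, ∀ y' ∈ J j, κ x y = κ x' y'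

/-- A kernel is *irreducible on `T`* if every measurable `A ⊆ T` with `κ = 0` a.e. on
`A × (T \ A)` satisfies `μ(A) = 0` or `μ(T \ A) = 0`. -/
def KernelIrreducibleOn (μ : Measure S) (κ : S → S → ℝ) (T : Set S) : Prop :=
  ∀ A : Set S, MeasurableSet A → A ⊆ T →
    (∀ᵐ q ∂(μ.prod μ), q.1 ∈ A → q.2 ∈ T \ A → κ q.1 q.2 = 0) →
    μ A = 0 ∨ μ (T \ A) = 0

/-- A kernel is *quasi-irreducible* if there is a μ-continuity set `S'` of positive measure on
which its restriction is irreducible, and the kernel vanishes off `S' × S'`. -/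
def QuasiIrreducible (μ : Measure S) (κ : S → S → ℝ) : Prop :=
  ∃ S' : Set S, MeasurableSet S' ∧ μ (frontier S') = 0 ∧ 0 < μ S' ∧
    KernelIrreducibleOn μ κ S' ∧ ∀ x y, x ∉ S' ∨ y ∉ S' → κ x y = 0

end KernelDefs


section Fin
variable {ι : Type*} [Fintype ι]

lemma pf_max [Nonempty ι] (M : ι → ι → ℝ) (hM : ∀ i j, 0 ≤ M i j) :
    ∃ r : ℝ, 0 ≤ r ∧ r ≤ ∑ i, ∑ j, M i j ∧ ∃ v ∈ stdSimplex ℝ ι,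
      (∀ i, r * v i ≤ ∑ j, M i j * v j) ∧
      ∀ w : ι → ℝ, (∀ i, 0 ≤ w i) → w ≠ 0 → ∀ l : ℝ,
        (∀ i, l * w i ≤ ∑ j, M i j * w j) → l ≤ r := by
  classical
  set B := ∑ i, ∑ j, M i j with hB
  have hB0 : 0 ≤ B := Finset.sum_nonneg fun i _ => Finset.sum_nonneg fun j _ => hM i j
  set C : Set (ℝ × (ι → ℝ)) := (Set.Icc 0 B ×ˢ stdSimplex ℝ ι) ∩
    {p | ∀ i, p.1 * p.2 i ≤ ∑ j, M i j * p.2 j} with hC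
  have hCc : IsCompact C := by
    apply (isCompact_Icc.prod (isCompact_stdSimplex ℝ ι)).inter_right
    simp only [Set.ofPred_forall]
    exact isClosed_iInter fun i => isClosed_le (by fun_prop) (by fun_prop)
  obtain ⟨i0⟩ := ‹Nonempty ι›
  have hCn : C.Nonempty := by
    refine ⟨(0, Pi.single i0 1), ⟨⟨⟨le_refl _, hB0⟩, single_mem_stdSimplex ℝ i0⟩, ?_⟩⟩
    intro i
    simp only [zero_mul]
    exact Finset.sum_nonneg fun j _ => mul_nonneg (hM i j) ((single_mem_stdSimplex ℝ i0).1 j)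
  obtain ⟨⟨r, v⟩, hrv, hmax⟩ := hCc.exists_isMaxOn hCn continuous_fst.continuousOn
  refine ⟨r, hrv.1.1.1, hrv.1.1.2, v, hrv.1.2, hrv.2, ?_⟩
  intro w hw hw0 l hl
  rcases lt_or_ge l 0 with hl0 | hl0
  · exact hl0.le.trans hrv.1.1.1
  have hs : 0 < ∑ i, w i := by
    obtain ⟨i, hi⟩ := Function.ne_iff.mp hw0
    exact Finset.sum_pos' (fun i _ => hw i) ⟨i, Finset.mem_univ _, lt_of_le_of_ne (hw i) (Ne.symm hi)⟩
  set s := ∑ i, w i with hsdef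
  have hu : (fun i => s⁻¹ * w i) ∈ stdSimplex ℝ ι :=
    ⟨fun i => mul_nonneg (inv_nonneg.2 hs.le) (hw i), by
      rw [← Finset.mul_sum]; exact inv_mul_cancel₀ hs.ne'⟩
  have hlu : ∀ i, l * (s⁻¹ * w i) ≤ ∑ j, M i j * (s⁻¹ * w j) := by
    intro i
    have := mul_le_mul_of_nonneg_left (hl i) (inv_nonneg.2 hs.le)
    calc l * (s⁻¹ * w i) = s⁻¹ * (l * w i) := by ring
      _ ≤ s⁻¹ * ∑ j, M i j * w j := this
      _ = _ := by rw [Finset.mul_sum]; exact Finset.sum_congr rfl fun j _ => by ring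
  have hlB : l ≤ B := by
    have h1 : ∑ i, l * (s⁻¹ * w i) = l := by rw [← Finset.mul_sum, hu.2, mul_one]
    rw [← h1, hB]
    refine Finset.sum_le_sum fun i _ => (hlu i).trans (Finset.sum_le_sum fun j _ => ?_)
    refine mul_le_of_le_one_right (hM i j) ?_
    rw [← hu.2]
    exact Finset.single_le_sum (f := fun i => s⁻¹ * w i) (fun i _ => hu.1 i) (Finset.mem_univ j)
  exact hmax (show (l, fun i => s⁻¹ * w i) ∈ C from ⟨⟨⟨hl0, hlB⟩, hu⟩, hlu⟩)

lemma pf_eps [Nonempty ι] (a w : ι → ℝ) (ha : ∀ i, 0 < a i) (hw : ∀ i, 0 < w i) :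
    ∃ ε > 0, ∀ i, ε * w i ≤ a i := by
  obtain ⟨i, hi⟩ := Finite.exists_min (fun i => a i / w i)
  exact ⟨a i / w i, div_pos (ha i) (hw i), fun j => (le_div_iff₀ (hw j)).1 (hi j)⟩

lemma pf_strict [Nonempty ι] (M : ι → ι → ℝ) (hM : ∀ i j, 0 < M i j) :
    ∃ r : ℝ, 0 ≤ r ∧ r ≤ ∑ i, ∑ j, M i j ∧ ∃ v ∈ stdSimplex ℝ ι,
      (∀ i, r * v i = ∑ j, M i j * v j) ∧
      ∀ w : ι → ℝ, (∀ i, 0 ≤ w i) → w ≠ 0 → ∀ l : ℝ,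
        (∀ i, l * w i ≤ ∑ j, M i j * w j) → l ≤ r := by
  obtain ⟨r, hr0, hrB, v, hv, hrv, hmax⟩ := pf_max M fun i j => (hM i j).le
  refine ⟨r, hr0, hrB, v, hv, ?_, hmax⟩
  by_contra! hne
  obtain ⟨i0, hi0⟩ := hne
  have hpos : ∀ u : ι → ℝ, (∀ i, 0 ≤ u i) → (∃ i, 0 < u i) → ∀ i, 0 < ∑ j, M i j * u j := by
    rintro u hu ⟨k, hk⟩ i
    exact Finset.sum_pos' (fun j _ => mul_nonneg (hM i j).le (hu j))
      ⟨k, Finset.mem_univ _, mul_pos (hM i k) hk⟩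
  have hvp : ∃ i, 0 < v i := by
    by_contra! h
    have : ∑ i, v i ≤ 0 := Finset.sum_nonpos fun i _ => h i
    rw [hv.2] at this; linarith
  set w : ι → ℝ := fun i => ∑ j, M i j * v j with hwdef
  have hw : ∀ i, 0 < w i := hpos v hv.1 hvp
  have hd := hpos (fun i => w i - r * v i) (fun i => sub_nonneg.2 (hrv i))
    ⟨i0, sub_pos.2 (lt_of_le_of_ne (hrv i0) hi0)⟩
  obtain ⟨ε, hε, he⟩ := pf_eps _ w hd hw
  have := hmax w (fun i => (hw i).le) (fun h => (hw i0).ne' (congrFun h i0)) (r + ε) (fun i => by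
    have h1 := he i
    have h2 : ∑ j, M i j * (w j - r * v j) = ∑ j, M i j * w j - r * w i := by
      rw [hwdef]
      simp only [mul_sub, Finset.sum_sub_distrib, Finset.mul_sum]
      congr 1
      exact Finset.sum_congr rfl fun j _ => by ring
    simp only [h2] at h1
    linarith)
  linarith

lemma pf_weak [Nonempty ι] (M : ι → ι → ℝ) (hM : ∀ i j, 0 ≤ M i j) :
    ∃ r : ℝ, 0 ≤ r ∧ ∃ v : ι → ℝ, (∀ i, 0 ≤ v i) ∧ v ≠ 0 ∧
      (∀ i, r * v i = ∑ j, M i j * v j) ∧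
      ∀ w : ι → ℝ, (∀ i, 0 ≤ w i) → w ≠ 0 → ∀ l : ℝ,
        (∀ i, l * w i ≤ ∑ j, M i j * w j) → l ≤ r := by
  have key := fun k : ℕ => pf_strict (fun i j => M i j + 1 / ((k : ℝ) + 1))
    (fun i j => add_pos_of_nonneg_of_pos (hM i j) (by positivity))
  choose r hr0 hrB v hv hrv hmax using key
  have hmem : ∀ k, (r k, v k) ∈ Set.Icc 0 (∑ i, ∑ j, (M i j + 1)) ×ˢ stdSimplex ℝ ι := by
    intro k
    refine ⟨⟨hr0 k, (hrB k).trans ?_⟩, hv k⟩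
    refine Finset.sum_le_sum fun i _ => Finset.sum_le_sum fun j _ => ?_
    have : 1 / ((k : ℝ) + 1) ≤ 1 := by
      rw [div_le_one (by positivity)]; linarith [(Nat.cast_nonneg k : (0 : ℝ) ≤ k)]
    linarith
  obtain ⟨⟨a, u⟩, hau, φ, hφ, hlim⟩ :=
    (isCompact_Icc.prod (isCompact_stdSimplex ℝ ι)).tendsto_subseq hmem
  have hl1 : Filter.Tendsto (fun k => r (φ k)) Filter.atTop (nhds a) :=
    (continuous_fst.tendsto _).comp hlim
  have hl2 : Filter.Tendsto (fun k => v (φ k)) Filter.atTop (nhds u) :=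
    (continuous_snd.tendsto _).comp hlim
  have hl2' : ∀ i, Filter.Tendsto (fun k => v (φ k) i) Filter.atTop (nhds (u i)) :=
    tendsto_pi_nhds.1 hl2
  have hε : Filter.Tendsto (fun k => 1 / ((φ k : ℝ) + 1)) Filter.atTop (nhds 0) :=
    tendsto_one_div_add_atTop_nhds_zero_nat.comp hφ.tendsto_atTop
  refine ⟨a, hau.1.1, u, hau.2.1, ?_, ?_, ?_⟩
  · rintro rfl
    have := hau.2.2
    simp at this
  · intro i
    have h1 := hl1.mul (hl2' i)
    have h2 : Filter.Tendsto (fun k => ∑ j, (M i j + 1 / ((φ k : ℝ) + 1)) * v (φ k) j)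
        Filter.atTop (nhds (∑ j, (M i j + 0) * u j)) :=
      tendsto_finsetSum _ fun j _ => (hε.const_add _).mul (hl2' j)
    simp only [add_zero] at h2
    refine tendsto_nhds_unique h1 (h2.congr fun k => ?_)
    exact (hrv (φ k) i).symm
  · intro w hw hw0 l hl
    refine ge_of_tendsto' hl1 fun k => hmax (φ k) w hw hw0 l fun i => (hl i).trans ?_
    refine Finset.sum_le_sum fun j _ => mul_le_mul_of_nonneg_right ?_ (hw j)
    have : 0 ≤ 1 / ((φ k : ℝ) + 1) := by positivity
    linarith

/-- eigenvalue of the transposed weighted matrix -/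
lemma pf_transpose (K : ι → ι → ℝ) (m : ι → ℝ) (hK : ∀ i j, 0 ≤ K i j) (hm : ∀ i, 0 < m i)
    (r : ℝ) (hr : 0 ≤ r) (v : ι → ℝ) (hv : v ≠ 0) (hrv : ∀ i, r * v i = ∑ j, K i j * m j * v j) :
    ∃ w : ι → ℝ, (∀ i, 0 ≤ w i) ∧ w ≠ 0 ∧ ∀ i, r * w i ≤ ∑ j, K j i * m j * w j := by
  classical
  set A : Matrix ι ι ℝ := Matrix.of (fun i j => K i j * m j) - r • (1 : Matrix ι ι ℝ) with hA
  have hdet : A.det = 0 := by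
    rw [← Matrix.exists_mulVec_eq_zero_iff]
    refine ⟨v, hv, ?_⟩
    rw [hA, Matrix.sub_mulVec, Matrix.smul_mulVec, Matrix.one_mulVec]
    ext i
    simp [Matrix.mulVec, dotProduct, hrv i]
  obtain ⟨x, hx0, hx⟩ := Matrix.exists_vecMul_eq_zero_iff.2 hdet
  have hx' : ∀ j, r * x j = ∑ i, x i * (K i j * m j) := by
    intro j
    have := congrFun hx j
    rw [hA, Matrix.vecMul_sub, Matrix.vecMul_smul, Matrix.vecMul_one] at this
    simp [Matrix.vecMul, dotProduct] at this
    linarith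
  refine ⟨fun i => |x i| / m i, fun i => div_nonneg (abs_nonneg _) (hm i).le, ?_, ?_⟩
  · obtain ⟨i, hi⟩ := Function.ne_iff.1 hx0
    intro h
    have := congrFun h i
    simp at this
    rcases this with h | h
    · exact hi h
    · exact (hm i).ne' h
  · intro i
    have h1 : r * (|x i| / m i) = |∑ j, x j * K j i| := by
      have : r * x i = (∑ j, x j * K j i) * m i := by
        rw [hx' i, Finset.sum_mul]; exact Finset.sum_congr rfl fun j _ => by ring
      have h2 : |r * x i| = |∑ j, x j * K j i| * m i := by
        rw [this, abs_mul, abs_of_pos (hm i)]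
      rw [abs_mul, abs_of_nonneg hr] at h2
      rw [← mul_div_assoc, h2, mul_div_cancel_right₀ _ (hm i).ne']
    rw [h1]
    refine (Finset.abs_sum_le_sum_abs _ _).trans (Finset.sum_le_sum fun j _ => ?_)
    rw [abs_mul, abs_of_nonneg (hK j i)]
    have := (hm j).ne'
    apply le_of_eq
    field_simp

/-- combinatorial irreducibility on the index set `P` -/
def FinIrr (K : ι → ι → ℝ) (P : Set ι) : Prop :=
  (∀ i, i ∉ P → ∀ j, K i j = 0 ∧ K j i = 0) ∧
  ∀ A ⊆ P, (∀ i ∈ A, ∀ j ∈ P \ A, K i j = 0) → A = ∅ ∨ A = P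

lemma FinIrr.symm {K : ι → ι → ℝ} {P : Set ι} (h : FinIrr K P) : FinIrr (fun i j => K j i) P := by
  refine ⟨fun i hi j => (h.1 i hi j).symm, fun A hA hz => ?_⟩
  rcases h.2 (P \ A) Set.sdiff_subset (fun i hi j hj => hz j (by
    by_contra hjA; exact hj.2 ⟨hj.1, hjA⟩) i hi) with h | h
  · right; exact hA.antisymm (Set.sdiff_eq_empty.1 h)
  · left
    ext i
    simp only [Set.mem_empty_iff_false, iff_false]
    intro hi
    have : i ∈ P \ A := by rw [h]; exact hA hi
    exact this.2 hi

lemma pf_pos (K : ι → ι → ℝ) (m : ι → ℝ) (P : Set ι) (hP : FinIrr K P)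
    (hK : ∀ i j, 0 ≤ K i j) (hm : ∀ i, 0 < m i)
    (l : ℝ) (hl : 0 < l) (v : ι → ℝ) (hv0 : ∀ i, 0 ≤ v i)
    (hlv : ∀ i, l * v i = ∑ j, K i j * m j * v j) :
    (∀ i, i ∉ P → v i = 0) ∧ (v ≠ 0 → ∀ i ∈ P, 0 < v i) := by
  have h1 : ∀ i, i ∉ P → v i = 0 := by
    intro i hi
    have := hlv i
    simp only [(hP.1 i hi _).1, zero_mul, Finset.sum_const_zero] at this
    exact (mul_eq_zero.1 this).resolve_left hl.ne'
  refine ⟨h1, fun hv i hi => ?_⟩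
  rcases hP.2 {i | i ∈ P ∧ v i = 0} (fun i hi => hi.1) (by
    rintro i ⟨hiP, hi⟩ j ⟨hjP, hj⟩
    have h2 := hlv i
    rw [hi, mul_zero, eq_comm, Finset.sum_eq_zero_iff_of_nonneg (fun j _ =>
      mul_nonneg (mul_nonneg (hK i j) (hm j).le) (hv0 j))] at h2
    have h3 := h2 j (Finset.mem_univ _)
    have h4 : v j ≠ 0 := fun h => hj ⟨hjP, h⟩
    simpa [h4, (hm j).ne'] using h3) with h | h
  · refine lt_of_le_of_ne (hv0 i) fun h0 => ?_
    have : i ∈ ({i | i ∈ P ∧ v i = 0} : Set ι) := ⟨hi, h0.symm⟩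
    rw [h] at this; exact this
  · refine absurd ?_ hv
    ext i
    by_cases hi : i ∈ P
    · rw [← h] at hi; exact hi.2
    · exact h1 i hi

lemma pf_unique (K : ι → ι → ℝ) (m : ι → ℝ) (P : Set ι) (hP : FinIrr K P)
    (hK : ∀ i j, 0 ≤ K i j) (hm : ∀ i, 0 < m i)
    (l r : ℝ) (hl : 0 < l) (hr : 0 < r) (v w : ι → ℝ) (hv0 : ∀ i, 0 ≤ v i) (hw0 : ∀ i, 0 ≤ w i)
    (hv : v ≠ 0) (hw : w ≠ 0)
    (hlv : ∀ i, l * v i = ∑ j, K i j * m j * v j) (hrw : ∀ i, r * w i = ∑ j, K i j * m j * w j)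
    (hlr : l ≤ r) :
    l = r ∧ ∃ c : ℝ, 0 < c ∧ ∀ i, v i = c * w i := by
  obtain ⟨hv1, hv2⟩ := pf_pos K m P hP hK hm l hl v hv0 hlv
  obtain ⟨hw1, hw2⟩ := pf_pos K m P hP hK hm r hr w hw0 hrw
  have hv2 := hv2 hv
  have hw2 := hw2 hw
  have hPn : P.Nonempty := by
    obtain ⟨i, hi⟩ := Function.ne_iff.1 hv
    exact ⟨i, by_contra fun h => hi (hv1 i h)⟩
  obtain ⟨i0, hi0, hmin⟩ := Set.exists_min_image P (fun i => v i / w i) P.toFinite hPn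
  set c := v i0 / w i0 with hc
  have hcpos : 0 < c := div_pos (hv2 i0 hi0) (hw2 i0 hi0)
  have hci0 : v i0 = c * w i0 := by rw [hc, div_mul_cancel₀ _ (hw2 i0 hi0).ne']
  have hge : ∀ i, 0 ≤ v i - c * w i := by
    intro i
    by_cases hi : i ∈ P
    · exact sub_nonneg.2 ((le_div_iff₀ (hw2 i hi)).1 (hmin i hi))
    · simp [hv1 i hi, hw1 i hi]
  have hsum : ∀ i, ∑ j, K i j * m j * (v j - c * w j) = l * v i - c * (r * w i) := by
    intro i
    rw [hlv, hrw, Finset.mul_sum, ← Finset.sum_sub_distrib]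
    exact Finset.sum_congr rfl fun j _ => by ring
  have hrl : r ≤ l := by
    have h1 : 0 ≤ ∑ j, K i0 j * m j * (v j - c * w j) := Finset.sum_nonneg fun j _ =>
      mul_nonneg (mul_nonneg (hK _ _) (hm _).le) (hge j)
    rw [hsum, hci0] at h1
    have h2 : 0 < c * w i0 := mul_pos hcpos (hw2 i0 hi0)
    nlinarith
  have heq : l = r := le_antisymm hlr hrl
  refine ⟨heq, c, hcpos, ?_⟩
  obtain ⟨-, h2⟩ := pf_pos K m P hP hK hm l hl (fun i => v i - c * w i) hge (fun i => by
    rw [hsum, heq]; ring)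
  by_contra! hne
  obtain ⟨k, hk⟩ := hne
  have := h2 (fun h => hk (sub_eq_zero.1 (congrFun h k))) i0 hi0
  linarith

end Fin

section Mid
variable {S : Type*} [MeasurableSpace S] {ι : Type*} [Fintype ι]

/-- step function with values `v i` on `J i` -/
noncomputable def stepLp (μ : Measure S) [IsProbabilityMeasure μ] (J : ι → Set S)
    (hJ : ∀ i, MeasurableSet (J i)) (v : ι → ℂ) : Lp ℂ 2 μ :=
  ∑ i, v i • indicatorConstLp 2 (hJ i) (measure_ne_top μ (J i)) (1 : ℂ)

lemma stepLp_ae (μ : Measure S) [IsProbabilityMeasure μ] (J : ι → Set S)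
    (hJ : ∀ i, MeasurableSet (J i))
    (hd : Pairwise fun i j => Disjoint (J i) (J j))
    (v : ι → ℂ) : ∀ᵐ x ∂μ, ∀ i, x ∈ J i → stepLp μ J hJ v x = v i := by
  have h1 : ⇑(stepLp μ J hJ v) =ᵐ[μ]
      ∑ i, ⇑(v i • indicatorConstLp 2 (hJ i) (measure_ne_top μ (J i)) (1 : ℂ)) :=
    Lp.coeFn_finsetSum _ _
  have h2 : ∀ᵐ x ∂μ, ∀ i, (v i • indicatorConstLp 2 (hJ i) (measure_ne_top μ (J i)) (1 : ℂ) :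
      Lp ℂ 2 μ) x = v i * (J i).indicator (fun _ => (1 : ℂ)) x := by
    rw [ae_all_iff]
    intro i
    filter_upwards [Lp.coeFn_smul (v i) (indicatorConstLp 2 (hJ i) (measure_ne_top μ (J i)) (1 : ℂ)),
      indicatorConstLp_coeFn (p := 2) (hs := hJ i) (hμs := measure_ne_top μ (J i)) (c := (1 : ℂ))]
      with x hx hx'
    rw [hx, Pi.smul_apply, hx', smul_eq_mul]
  filter_upwards [h1, h2] with x hx hx2 i hi
  rw [hx, Finset.sum_apply, Finset.sum_eq_single i]
  · rw [hx2, Set.indicator_of_mem hi, mul_one]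
  · intro j _ hji
    rw [hx2, Set.indicator_of_notMem, mul_zero]
    exact fun hj => Set.disjoint_left.1 (hd hji) hj hi
  · simp

lemma step_ext (μ : Measure S) [IsProbabilityMeasure μ] (J : ι → Set S)
    (hcov : ∀ᵐ x ∂μ, ∃ i, x ∈ J i)
    {f g : Lp ℂ 2 μ} (h : ∀ᵐ x ∂μ, ∀ i, x ∈ J i → f x = g x) : f = g := by
  apply Lp.ext
  filter_upwards [h, hcov] with x hx ⟨i, hi⟩
  exact hx i hi

lemma stepLp_inj (μ : Measure S) [IsProbabilityMeasure μ] (J : ι → Set S)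
    (hJ : ∀ i, MeasurableSet (J i))
    (hd : Pairwise fun i j => Disjoint (J i) (J j))
    (hpos : ∀ i, 0 < μ (J i)) {v w : ι → ℂ} (h : stepLp μ J hJ v = stepLp μ J hJ w) :
    v = w := by
  ext i
  have h1 : ∀ᵐ x ∂μ, x ∈ J i → v i = w i := by
    filter_upwards [stepLp_ae μ J hJ hd v, stepLp_ae μ J hJ hd w] with x hx hx' hi
    rw [← hx i hi, ← hx' i hi, h]
  by_contra hne
  have : μ (J i) = 0 := by
    rw [measure_eq_zero_iff_ae_notMem]
    filter_upwards [h1] with x hx hi using hne (hx hi)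
  exact (hpos i).ne' this

lemma stepLp_int (μ : Measure S) [IsProbabilityMeasure μ] (J : ι → Set S)
    (hJ : ∀ i, MeasurableSet (J i))
    (hd : Pairwise fun i j => Disjoint (J i) (J j))
    (v : ι → ℂ) (i : ι) :
    ∫ y in J i, stepLp μ J hJ v y ∂μ = (μ.real (J i) : ℂ) * v i := by
  rw [setIntegral_congr_ae (g := fun _ => v i) (hJ i) (by
    filter_upwards [stepLp_ae μ J hJ hd v] with x hx hi using hx i hi)]
  simp

lemma int_eq (μ : Measure S) [IsProbabilityMeasure μ] (J : ι → Set S)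
    (hJ : ∀ i, MeasurableSet (J i))
    (hd : Pairwise fun i j => Disjoint (J i) (J j))
    (hcov : ∀ᵐ x ∂μ, ∃ i, x ∈ J i)
    (κ : S → S → ℝ) (K : ι → ι → ℝ)
    (hK : ∀ i j, ∀ x ∈ J i, ∀ y ∈ J j, κ x y = K i j)
    (f : Lp ℂ 2 μ) (i : ι) (x : S) (hx : x ∈ J i) :
    ∫ y, (κ x y : ℂ) * f y ∂μ = ∑ j, (K i j : ℂ) * ∫ y in J j, f y ∂μ := by
  have hf : Integrable f μ := (Lp.memLp f).integrable (by norm_num)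
  have heq : ∀ j, ∀ y ∈ J j, (κ x y : ℂ) * f y = (K i j : ℂ) * f y := fun j y hy => by
    rw [hK i j x hx y hy]
  have hU : (⋃ j, J j) =ᵐ[μ] Set.univ := by
    rw [Filter.eventuallyEq_univ]
    filter_upwards [hcov] with x hx using Set.mem_iUnion.2 hx
  rw [← setIntegral_univ, ← setIntegral_congr_set hU, integral_iUnion_fintype hJ hd]
  · refine Finset.sum_congr rfl fun j _ => ?_
    rw [setIntegral_congr_fun (hJ j) (heq j), integral_const_mul]
  · intro j
    have h0 : IntegrableOn (fun y => (K i j : ℂ) * f y) (J j) μ :=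
      (hf.integrableOn (s := J j)).const_mul (K i j : ℂ)
    exact h0.congr_fun (fun y hy => (heq j y hy).symm) (hJ j)

lemma T_eq (μ : Measure S) [IsProbabilityMeasure μ] (J : ι → Set S)
    (hJ : ∀ i, MeasurableSet (J i))
    (hd : Pairwise fun i j => Disjoint (J i) (J j))
    (hcov : ∀ᵐ x ∂μ, ∃ i, x ∈ J i)
    (κ : S → S → ℝ) (K : ι → ι → ℝ)
    (hK : ∀ i j, ∀ x ∈ J i, ∀ y ∈ J j, κ x y = K i j)
    (T : Lp ℂ 2 μ →L[ℂ] Lp ℂ 2 μ)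
    (hT : ∀ f : Lp ℂ 2 μ, ⇑(T f) =ᵐ[μ] fun x => ∫ y, (κ x y : ℂ) * f y ∂μ)
    (f : Lp ℂ 2 μ) :
    T f = stepLp μ J hJ (fun i => ∑ j, (K i j : ℂ) * ∫ y in J j, f y ∂μ) := by
  apply step_ext μ J hcov
  filter_upwards [hT f, stepLp_ae μ J hJ hd (fun i => ∑ j, (K i j : ℂ) * ∫ y in J j, f y ∂μ)]
    with x hx hx' i hi
  rw [hx, hx' i hi, int_eq μ J hJ hd hcov κ K hK f i x hi]

lemma stepLp_smul (μ : Measure S) [IsProbabilityMeasure μ] (J : ι → Set S)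
    (hJ : ∀ i, MeasurableSet (J i))
    (a : ℂ) (v : ι → ℂ) : a • stepLp μ J hJ v = stepLp μ J hJ (fun i => a * v i) := by
  simp [stepLp, Finset.smul_sum, mul_smul]

lemma T_compact (μ : Measure S) [IsProbabilityMeasure μ] (J : ι → Set S)
    (hJ : ∀ i, MeasurableSet (J i))
    (hd : Pairwise fun i j => Disjoint (J i) (J j))
    (hcov : ∀ᵐ x ∂μ, ∃ i, x ∈ J i)
    (κ : S → S → ℝ) (K : ι → ι → ℝ)
    (hK : ∀ i j, ∀ x ∈ J i, ∀ y ∈ J j, κ x y = K i j)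
    (T : Lp ℂ 2 μ →L[ℂ] Lp ℂ 2 μ)
    (hT : ∀ f : Lp ℂ 2 μ, ⇑(T f) =ᵐ[μ] fun x => ∫ y, (κ x y : ℂ) * f y ∂μ)
    : IsCompactOperator T := by
  set W : Submodule ℂ (Lp ℂ 2 μ) := Submodule.span ℂ (Set.range fun i =>
    (indicatorConstLp 2 (hJ i) (measure_ne_top μ (J i)) (1 : ℂ) : Lp ℂ 2 μ)) with hW
  have : FiniteDimensional ℂ W := FiniteDimensional.span_of_finite ℂ (Set.finite_range _)
  have : ProperSpace W := FiniteDimensional.proper ℂ W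
  have hmem : ∀ f, T f ∈ W := by
    intro f
    rw [T_eq μ J hJ hd hcov κ K hK T hT]
    exact Submodule.sum_mem _ fun i _ => Submodule.smul_mem _ _ (Submodule.subset_span ⟨i, rfl⟩)
  have h1 : IsCompactOperator (T.codRestrict W hmem) :=
    isCompactOperator_of_locallyCompactSpace_dom (T.codRestrict W hmem)
  exact h1.clm_comp W.subtypeL

/-- nonzero eigenvectors are step functions -/
lemma T_eigen (μ : Measure S) [IsProbabilityMeasure μ] (J : ι → Set S)
    (hJ : ∀ i, MeasurableSet (J i))
    (hd : Pairwise fun i j => Disjoint (J i) (J j))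
    (hcov : ∀ᵐ x ∂μ, ∃ i, x ∈ J i)
    (κ : S → S → ℝ) (K : ι → ι → ℝ)
    (hK : ∀ i j, ∀ x ∈ J i, ∀ y ∈ J j, κ x y = K i j)
    (T : Lp ℂ 2 μ →L[ℂ] Lp ℂ 2 μ)
    (hT : ∀ f : Lp ℂ 2 μ, ⇑(T f) =ᵐ[μ] fun x => ∫ y, (κ x y : ℂ) * f y ∂μ)
    (f : Lp ℂ 2 μ) (l : ℂ) (hl : l ≠ 0) (hf : T f = l • f) :
    ∃ v : ι → ℂ, f = stepLp μ J hJ v ∧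
      (∀ i, v i = l⁻¹ * ∑ j, (K i j : ℂ) * ∫ y in J j, f y ∂μ) ∧
      (∀ i, l * v i = ∑ j, ((K i j * μ.real (J j) : ℝ) : ℂ) * v j) := by
  have h1 : f = stepLp μ J hJ (fun i => l⁻¹ * ∑ j, (K i j : ℂ) * ∫ y in J j, f y ∂μ) := by
    rw [← stepLp_smul, ← T_eq μ J hJ hd hcov κ K hK T hT, hf, smul_smul, inv_mul_cancel₀ hl,
      one_smul]
  refine ⟨_, h1, fun i => rfl, fun i => ?_⟩
  rw [mul_inv_cancel_left₀ hl]
  refine Finset.sum_congr rfl fun j _ => ?_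
  conv_lhs => rw [h1, stepLp_int μ J hJ hd]
  push_cast
  ring

lemma T_core (μ : Measure S) [IsProbabilityMeasure μ] (J : ι → Set S)
    (hJ : ∀ i, MeasurableSet (J i))
    (hd : Pairwise fun i j => Disjoint (J i) (J j))
    (hcov : ∀ᵐ x ∂μ, ∃ i, x ∈ J i)
    (κ : S → S → ℝ) (K : ι → ι → ℝ)
    (hK : ∀ i j, ∀ x ∈ J i, ∀ y ∈ J j, κ x y = K i j)
    (T : Lp ℂ 2 μ →L[ℂ] Lp ℂ 2 μ)
    (hT : ∀ f : Lp ℂ 2 μ, ⇑(T f) =ᵐ[μ] fun x => ∫ y, (κ x y : ℂ) * f y ∂μ)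
    (hpos : ∀ i, 0 < μ (J i)) (hK0 : ∀ i j, 0 ≤ K i j) (P : Set ι) (hP : FinIrr K P)
    (r : ℝ) (hr : 0 ≤ r) (v : ι → ℝ) (hv : ∀ i, 0 ≤ v i) (hv0 : v ≠ 0)
    (hrv : ∀ i, r * v i = ∑ j, K i j * μ.real (J j) * v j)
    (hmax : ∀ w : ι → ℝ, (∀ i, 0 ≤ w i) → w ≠ 0 → ∀ l : ℝ,
        (∀ i, l * w i ≤ ∑ j, K i j * μ.real (J j) * w j) → l ≤ r) :
    spectralRadius ℂ T = ENNReal.ofReal r ∧ ∃ f : Lp ℂ 2 μ, f ≠ 0 ∧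
      (∀ᵐ x ∂μ, 0 ≤ (f x).re ∧ (f x).im = 0) ∧ T f = (r : ℂ) • f ∧
      (∀ (g : Lp ℂ 2 μ) (l : ℝ), g ≠ 0 → (∀ᵐ x ∂μ, 0 ≤ (g x).re ∧ (g x).im = 0) →
          0 < l → T g = (l : ℂ) • g → l = r ∧ ∃ c : ℝ, 0 < c ∧ g = (c : ℂ) • f) := by
  have hz : stepLp μ J hJ (0 : ι → ℂ) = 0 := by simp [stepLp]
  set f := stepLp μ J hJ (fun i => (v i : ℂ)) with hf
  have hf0 : f ≠ 0 := by
    intro h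
    rw [← hz] at h
    have := stepLp_inj μ J hJ hd hpos h
    apply hv0
    ext i
    have := congrFun this i
    simpa using this
  have hTf : T f = (r : ℂ) • f := by
    rw [T_eq μ J hJ hd hcov κ K hK T hT, hf, stepLp_smul]
    congr 1
    ext i
    simp only [stepLp_int μ J hJ hd]
    have := congrArg (fun t : ℝ => (t : ℂ)) (hrv i)
    push_cast at this
    rw [this]
    exact Finset.sum_congr rfl fun j _ => by ring
  refine ⟨?_, f, hf0, ?_, hTf, ?_⟩
  · apply le_antisymm
    · refine iSup₂_le fun l hl => ?_
      by_cases hl0 : l = 0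
      · simp [hl0]
      have hev := ((T_compact μ J hJ hd hcov κ K hK T hT).hasEigenvalue_iff_mem_spectrum hl0).2 hl
      obtain ⟨g, hg⟩ := hev.exists_hasEigenvector
      obtain ⟨w, hw, -, hlw⟩ := T_eigen μ J hJ hd hcov κ K hK T hT g l hl0 hg.apply_eq_smul
      have hle : ‖l‖ ≤ r := by
        refine hmax (fun i => ‖w i‖) (fun i => norm_nonneg _) ?_ _ fun i => ?_
        · intro h
          apply hg.2
          have : w = 0 := by ext i; exact norm_eq_zero.1 (congrFun h i)
          rw [hw, this, hz]
        · rw [← norm_mul, hlw]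
          refine (norm_sum_le _ _).trans (Finset.sum_le_sum fun j _ => ?_)
          rw [norm_mul, Complex.norm_real, Real.norm_of_nonneg
            (mul_nonneg (hK0 i j) measureReal_nonneg)]
      rw [ENNReal.ofReal, ENNReal.coe_le_coe]
      exact NNReal.le_toNNReal_of_coe_le (by simpa using hle)
    · have hmem : (r : ℂ) ∈ spectrum ℂ T := by
        rw [ContinuousLinearMap.spectrum_eq]
        apply Module.End.HasEigenvalue.mem_spectrum
        exact Module.End.hasEigenvalue_of_hasEigenvector
          (Module.End.hasEigenvector_iff.2 ⟨Module.End.mem_eigenspace_iff.2 hTf, hf0⟩)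
      refine le_trans (le_of_eq ?_) (le_iSup₂ (f := fun (k : ℂ) (_ : k ∈ spectrum ℂ T) =>
        (‖k‖₊ : ENNReal)) (r : ℂ) hmem)
      rw [ENNReal.ofReal]
      congr 1
      ext
      simp [abs_of_nonneg hr, hr]
  · filter_upwards [stepLp_ae μ J hJ hd (fun i => (v i : ℂ)), hcov] with x hx ⟨i, hi⟩
    rw [hf, hx i hi]
    simpa using hv i
  · intro g l hg0 hgn hl hTg
    obtain ⟨w, hw, hwi, hlw⟩ := T_eigen μ J hJ hd hcov κ K hK T hT g l (by exact_mod_cast hl.ne') hTg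
    have hI : ∀ j, ∫ y in J j, g y ∂μ = ((∫ y in J j, (g y).re ∂μ : ℝ) : ℂ) := by
      intro j
      rw [← integral_complex_ofReal]
      refine setIntegral_congr_ae (hJ j) ?_
      filter_upwards [hgn] with x hx _
      apply Complex.ext <;> simp [hx.2]
    have hI0 : ∀ j, 0 ≤ ∫ y in J j, (g y).re ∂μ := by
      intro j
      refine setIntegral_nonneg_of_ae (by filter_upwards [hgn] with x hx using hx.1)
    set u : ι → ℝ := fun i => l⁻¹ * ∑ j, K i j * ∫ y in J j, (g y).re ∂μ with hu
    have hwu : ∀ i, w i = (u i : ℂ) := by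
      intro i
      rw [hwi, hu]
      simp only [hI]
      push_cast
      rfl
    have hu0 : ∀ i, 0 ≤ u i := fun i => mul_nonneg (inv_nonneg.2 hl.le)
      (Finset.sum_nonneg fun j _ => mul_nonneg (hK0 i j) (hI0 j))
    have hlu : ∀ i, l * u i = ∑ j, K i j * μ.real (J j) * u j := by
      intro i
      have := hlw i
      simp only [hwu] at this
      exact_mod_cast this
    have hune : u ≠ 0 := by
      intro h
      apply hg0
      rw [hw, ← hz]
      congr 1
      ext i
      rw [hwu, h]; simp
    have hlr := hmax u hu0 hune l fun i => (hlu i).le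
    obtain ⟨h1, c, hc, huc⟩ := pf_unique K (fun j => μ.real (J j)) P hP hK0
      (fun j => ENNReal.toReal_pos (hpos j).ne' (measure_ne_top _ _)) l r hl (hl.trans_le hlr) u v hu0 hv
      hune hv0 hlu hrv hlr
    refine ⟨h1, c, hc, ?_⟩
    rw [hw, hf, stepLp_smul]
    congr 1
    ext i
    rw [hwu, huc]
    push_cast
    rfl

end Mid

section Irr
variable {S : Type*} [MeasurableSpace S] [TopologicalSpace S] {ι : Type*}

lemma fin_irr_of (μ : Measure S) [IsProbabilityMeasure μ] (J : ι → Set S) [Countable ι]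
    (hJ : ∀ i, MeasurableSet (J i)) (hd : Pairwise fun i j => Disjoint (J i) (J j))
    (hcov : ∀ᵐ x ∂μ, ∃ i, x ∈ J i) (hpos : ∀ i, 0 < μ (J i))
    (κ : S → S → ℝ) (K : ι → ι → ℝ) (hK : ∀ i j, ∀ x ∈ J i, ∀ y ∈ J j, κ x y = K i j)
    (hq : QuasiIrreducible μ κ) : ∃ P : Set ι, FinIrr K P := by
  obtain ⟨S', hS'm, -, -, hirr, hvan⟩ := hq
  have hne : ∀ i, (J i).Nonempty := fun i => nonempty_of_measure_ne_zero (hpos i).ne'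
  set P : Set ι := {i | 0 < μ (J i ∩ S')} with hP
  have h1 : ∀ i, i ∉ P → ∀ j, K i j = 0 ∧ K j i = 0 := by
    intro i hi j
    have h0 : μ (J i ∩ S') = 0 := by simpa [hP] using hi
    obtain ⟨x, hx, hxS⟩ : ∃ x ∈ J i, x ∉ S' := by
      by_contra! h
      rw [Set.inter_eq_left.2 h] at h0
      exact (hpos i).ne' h0
    obtain ⟨y, hy⟩ := hne j
    exact ⟨by rw [← hK i j x hx y hy, hvan x y (Or.inl hxS)],
      by rw [← hK j i y hy x hx, hvan y x (Or.inr hxS)]⟩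
  refine ⟨P, h1, fun A hA hz => ?_⟩
  have hBm : MeasurableSet ((⋃ i ∈ A, J i) ∩ S') :=
    (MeasurableSet.biUnion A.to_countable fun i _ => hJ i).inter hS'm
  rcases hirr _ hBm Set.inter_subset_right (by
    have hc2 : ∀ᵐ q ∂(μ.prod μ), ∃ i, q.2 ∈ J i :=
      Measure.quasiMeasurePreserving_snd.ae hcov
    filter_upwards [hc2] with q hq2 hq1 hq3
    obtain ⟨j, hj⟩ := hq2
    obtain ⟨i, hiA, hi⟩ := Set.mem_iUnion₂.1 hq1.1
    have hjA : j ∉ A := fun h => hq3.2 ⟨Set.mem_iUnion₂.2 ⟨j, h, hj⟩, hq3.1⟩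
    rw [hK i j _ hi _ hj]
    by_cases hjP : j ∈ P
    · exact hz i hiA j ⟨hjP, hjA⟩
    · exact (h1 j hjP i).2) with h | h
  · left
    ext i
    simp only [Set.mem_empty_iff_false, iff_false]
    intro hi
    refine (hA hi : 0 < μ (J i ∩ S')).ne' (measure_mono_null ?_ h)
    exact Set.inter_subset_inter_left _ (Set.subset_biUnion_of_mem (u := J) hi)
  · right
    refine hA.antisymm fun i hi => ?_
    by_contra hiA
    refine (hi : 0 < μ (J i ∩ S')).ne' (measure_mono_null ?_ h)
    rintro x ⟨hxi, hxS⟩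
    refine ⟨hxS, fun hx => ?_⟩
    obtain ⟨k, hkA, hk⟩ := Set.mem_iUnion₂.1 hx.1
    have hki : k ≠ i := by rintro rfl; exact hiA hkA
    exact Set.disjoint_left.1 (hd hki) hk hxi

end Irr

/-- **Proposition.** For a regular finitary, quasi-irreducible kernel `κ̃`, the operators
`T_{κ̃}⁺` and `T_{κ̃}⁻` have a common spectral radius `r ≥ 0` which is an eigenvalue with
nonnegative, non-zero eigenfunctions `f₊, f₋ ∈ L²(μ)`, and these are the unique (up to positive
constants and null sets) nonnegative eigenfunctions with positive eigenvalue. -/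
theorem kernel_ops_perron_frobenius
    {S : Type*} [MetricSpace S] [MeasurableSpace S] [BorelSpace S]
    (μ : Measure S) [IsProbabilityMeasure μ]
    (κ : S → S → ℝ) (hκmeas : Measurable (Function.uncurry κ)) (hκ0 : ∀ x y, 0 ≤ κ x y)
    (hreg : RegularFinitary μ κ) (hquasi : QuasiIrreducible μ κ)
    (Tp Tm : Lp ℂ 2 μ →L[ℂ] Lp ℂ 2 μ)
    (hTp : ∀ f : Lp ℂ 2 μ, ⇑(Tp f) =ᵐ[μ] fun x => ∫ y, (κ y x : ℂ) * f y ∂μ)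
    (hTm : ∀ f : Lp ℂ 2 μ, ⇑(Tm f) =ᵐ[μ] fun x => ∫ y, (κ x y : ℂ) * f y ∂μ) :
    ∃ r : ℝ, 0 ≤ r ∧
      spectralRadius ℂ Tp = ENNReal.ofReal r ∧ spectralRadius ℂ Tm = ENNReal.ofReal r ∧
      ∃ fp fm : Lp ℂ 2 μ, fp ≠ 0 ∧ fm ≠ 0 ∧
        (∀ᵐ x ∂μ, 0 ≤ (fp x).re ∧ (fp x).im = 0) ∧
        (∀ᵐ x ∂μ, 0 ≤ (fm x).re ∧ (fm x).im = 0) ∧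
        Tp fp = (r : ℂ) • fp ∧ Tm fm = (r : ℂ) • fm ∧
        (∀ (g : Lp ℂ 2 μ) (l : ℝ), g ≠ 0 → (∀ᵐ x ∂μ, 0 ≤ (g x).re ∧ (g x).im = 0) →
          0 < l → Tp g = (l : ℂ) • g → l = r ∧ ∃ c : ℝ, 0 < c ∧ g = (c : ℂ) • fp) ∧
        (∀ (g : Lp ℂ 2 μ) (l : ℝ), g ≠ 0 → (∀ᵐ x ∂μ, 0 ≤ (g x).re ∧ (g x).im = 0) →
          0 < l → Tm g = (l : ℂ) • g → l = r ∧ ∃ c : ℝ, 0 < c ∧ g = (c : ℂ) • fm) := by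
  classical
  obtain ⟨n, J0, hJ0m, -, hJ0d, hJ0c, hJ0K⟩ := hreg
  let ι := {i : Fin n // 0 < μ (J0 i)}
  let J : ι → Set S := fun i => J0 i.1
  have hJ : ∀ i, MeasurableSet (J i) := fun i => hJ0m i.1
  have hd : Pairwise fun i j => Disjoint (J i) (J j) := fun i j hij =>
    hJ0d fun h => hij (Subtype.ext h)
  have hpos : ∀ i, 0 < μ (J i) := fun i => i.2
  have hcov : ∀ᵐ x ∂μ, ∃ i, x ∈ J i := by
    have h0 : ∀ᵐ x ∂μ, ∀ i, μ (J0 i) = 0 → x ∉ J0 i := by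
      rw [ae_all_iff]
      intro i
      by_cases hi : μ (J0 i) = 0
      · filter_upwards [measure_eq_zero_iff_ae_notMem.1 hi] with x hx _ using hx
      · exact Filter.Eventually.of_forall fun x h => absurd h hi
    filter_upwards [h0] with x hx
    have hxu : x ∈ ⋃ i, J0 i := hJ0c ▸ Set.mem_univ x
    obtain ⟨i, hi⟩ := Set.mem_iUnion.1 hxu
    exact ⟨⟨i, pos_iff_ne_zero.2 fun h => hx i h hi⟩, hi⟩
  have hne : ∀ i, (J i).Nonempty := fun i => nonempty_of_measure_ne_zero (hpos i).ne'
  have : Nonempty ι := by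
    obtain ⟨x, i, -⟩ := hcov.exists
    exact ⟨i⟩
  choose p hp using hne
  let K : ι → ι → ℝ := fun i j => κ (p i) (p j)
  have hK : ∀ i j, ∀ x ∈ J i, ∀ y ∈ J j, κ x y = K i j := fun i j x hx y hy =>
    hJ0K i.1 j.1 x hx y hy _ (hp i) _ (hp j)
  have hK0 : ∀ i j, 0 ≤ K i j := fun i j => hκ0 _ _
  obtain ⟨P, hP⟩ := fin_irr_of μ J hJ hd hcov hpos κ K hK hquasi
  have hm : ∀ i, 0 < μ.real (J i) := fun j =>
    ENNReal.toReal_pos (hpos j).ne' (measure_ne_top _ _)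
  obtain ⟨r, hr, v, hv, hv0, hrv, hmax⟩ := pf_weak (fun i j => K i j * μ.real (J j))
    fun i j => mul_nonneg (hK0 i j) (hm j).le
  obtain ⟨r', hr', v', hv', hv0', hrv', hmax'⟩ := pf_weak (fun i j => K j i * μ.real (J j))
    fun i j => mul_nonneg (hK0 j i) (hm j).le
  have heq : r' = r := by
    apply le_antisymm
    · obtain ⟨w, hw, hw0, hwr⟩ := pf_transpose (fun i j => K j i) (fun j => μ.real (J j))
        (fun i j => hK0 j i) hm r' hr' v' hv0' hrv'
      exact hmax w hw hw0 r' hwr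
    · obtain ⟨w, hw, hw0, hwr⟩ := pf_transpose K (fun j => μ.real (J j))
        hK0 hm r hr v hv0 hrv
      exact hmax' w hw hw0 r hwr
  subst heq
  obtain ⟨hs1, fm, hfm0, hfmn, hfm, hum⟩ := T_core μ J hJ hd hcov κ K hK Tm hTm hpos hK0 P hP
    r' hr v hv hv0 hrv hmax
  obtain ⟨hs2, fp, hfp0, hfpn, hfp, hup⟩ := T_core μ J hJ hd hcov (fun x y => κ y x)
    (fun i j => K j i) (fun i j x hx y hy => hK j i y hy x hx) Tp hTp hpos (fun i j => hK0 j i) P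
    hP.symm r' hr v' hv' hv0' hrv' hmax'
  exact ⟨r', hr, hs2, hs1, fp, fm, hfp0, hfm0, hfpn, hfmn, hfp, hfm, hup, hum⟩
end

section
/- Let X and Y be independent Poisson random variables with means λ ≥ 0 and μ ≥ 0 respectively, where λ + μ > 0. Then for all a, b ∈ ℕ: E[ (a + X)/(b + X + Y) · 1(b + X + Y ≥ 1) ] ≤ 2a/(b+1) + (λ/(λ+μ))·(1 − e^{−λ−μ}). -/
open MeasureTheory ProbabilityTheory Filter

lemma stein_poisson (r : NNReal) (h : ℕ → ℝ) (C : ℝ) (hb : ∀ n : ℕ, |(n : ℝ) * h n| ≤ C) :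
    ∫ n : ℕ, (n : ℝ) * h n ∂(poissonMeasure r) = r * ∫ n : ℕ, h (n + 1) ∂(poissonMeasure r) := by
  have hint : Integrable (fun n : ℕ => (n : ℝ) * h n) (poissonMeasure r) :=
    Integrable.of_bound (by fun_prop) C (Filter.Eventually.of_forall hb)
  have hs := (hasSum_integral_poissonMeasure hint)
  rw [← hs.tsum_eq, hs.summable.tsum_eq_zero_add, integral_poissonMeasure, ← tsum_mul_left]
  simp only [Nat.cast_zero, zero_mul, mul_zero, zero_add, smul_eq_mul]
  refine tsum_congr fun n => ?_
  rw [Nat.factorial_succ]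
  have : (n.factorial : ℝ) ≠ 0 := by positivity
  have : (n : ℝ) + 1 ≠ 0 := by positivity
  push_cast
  field_simp
  try ring

lemma law_of (Ω : Type*) [MeasurableSpace Ω] (P : Measure Ω) [IsProbabilityMeasure P]
    (X : Ω → ℕ) (hX : Measurable X) (lam : NNReal)
    (hXd : ∀ k : ℕ, (P {ω | X ω = k}).toReal = Real.exp (-lam) * (lam : ℝ) ^ k / (Nat.factorial k : ℝ)) :
    P.map X = poissonMeasure lam := by
  apply Measure.ext_of_singleton
  intro k
  rw [Measure.map_apply hX (measurableSet_singleton k), poissonMeasure_singleton]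
  have := hXd k
  change (P (X ⁻¹' {k})).toReal = _ at this
  rw [← ENNReal.ofReal_toReal (measure_ne_top P (X ⁻¹' {k})), this]

lemma ratio_eq (r s : NNReal) (hrs : 0 < r + s) :
    ∫ z : ℕ × ℕ, (z.1 : ℝ) / ((z.1 : ℝ) + z.2) ∂((poissonMeasure r).prod (poissonMeasure s)) =
      (r : ℝ) / (r + s) * (1 - Real.exp (-r - s)) := by
  set Q := (poissonMeasure r).prod (poissonMeasure s) with hQ
  have h1 : ∀ z : ℕ × ℕ, |(z.1 : ℝ) / ((z.1 : ℝ) + z.2)| ≤ 1 := by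
    intro z
    rw [abs_of_nonneg (by positivity)]
    exact div_le_one_of_le₀ (by simp) (by positivity)
  have h2 : ∀ z : ℕ × ℕ, |(z.2 : ℝ) / ((z.1 : ℝ) + z.2)| ≤ 1 := by
    intro z
    rw [abs_of_nonneg (by positivity)]
    exact div_le_one_of_le₀ (by simp) (by positivity)
  have h3 : ∀ z : ℕ × ℕ, |(1 : ℝ) / ((z.1 : ℝ) + z.2 + 1)| ≤ 1 := by
    intro z
    rw [abs_of_nonneg (by positivity)]
    exact div_le_one_of_le₀ (by simp; positivity) (by positivity)
  have i1 : Integrable (fun z : ℕ × ℕ => (z.1 : ℝ) / ((z.1 : ℝ) + z.2)) Q :=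
    Integrable.of_bound (measurable_of_countable _).aestronglyMeasurable 1 (.of_forall h1)
  have i2 : Integrable (fun z : ℕ × ℕ => (z.2 : ℝ) / ((z.1 : ℝ) + z.2)) Q :=
    Integrable.of_bound (measurable_of_countable _).aestronglyMeasurable 1 (.of_forall h2)
  have i3 : Integrable (fun z : ℕ × ℕ => (1 : ℝ) / ((z.1 : ℝ) + z.2 + 1)) Q :=
    Integrable.of_bound (measurable_of_countable _).aestronglyMeasurable 1 (.of_forall h3)
  have e1 : ∫ z : ℕ × ℕ, (z.1 : ℝ) / ((z.1 : ℝ) + z.2) ∂Q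
      = r * ∫ z : ℕ × ℕ, (1 : ℝ) / ((z.1 : ℝ) + z.2 + 1) ∂Q := by
    rw [integral_prod_symm _ i1, integral_prod_symm _ i3, ← integral_const_mul]
    congr 1
    ext y
    have := stein_poisson r (fun n => 1 / ((n : ℝ) + y)) 1 (fun n => by
      have := h1 (n, y)
      simpa [div_eq_mul_inv] using this)
    simp only [mul_one_div] at this
    rw [this]
    congr 2
    ext n
    push_cast
    ring_nf
  have e2 : ∫ z : ℕ × ℕ, (z.2 : ℝ) / ((z.1 : ℝ) + z.2) ∂Q
      = s * ∫ z : ℕ × ℕ, (1 : ℝ) / ((z.1 : ℝ) + z.2 + 1) ∂Q := by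
    rw [integral_prod _ i2, integral_prod _ i3, ← integral_const_mul]
    congr 1
    ext y
    have := stein_poisson s (fun n => 1 / ((y : ℝ) + n)) 1 (fun n => by
      have := h2 (y, n)
      simpa [div_eq_mul_inv] using this)
    simp only [mul_one_div] at this
    rw [this]
    congr 2
    ext n
    push_cast
    ring_nf
  have e3 : ∫ z : ℕ × ℕ, (z.1 : ℝ) / ((z.1 : ℝ) + z.2) ∂Q
      + ∫ z : ℕ × ℕ, (z.2 : ℝ) / ((z.1 : ℝ) + z.2) ∂Q = 1 - Real.exp (-r - s) := by
    rw [← integral_add i1 i2]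
    have : (fun z : ℕ × ℕ => (z.1 : ℝ) / ((z.1 : ℝ) + z.2) + (z.2 : ℝ) / ((z.1 : ℝ) + z.2))
        = ({(0, 0)}ᶜ : Set (ℕ × ℕ)).indicator 1 := by
      ext ⟨x, y⟩
      by_cases h : (x, y) = (0, 0)
      · simp only [Prod.mk.injEq] at h
        simp [h.1, h.2]
      · rw [Set.indicator_of_mem (by simpa using h), ← add_div]
        have : x + y ≠ 0 := by
          intro h'
          apply h
          simp only [Prod.mk.injEq]
          omega
        have : (x : ℝ) + y ≠ 0 := by exact_mod_cast this
        exact div_self this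
    rw [this, integral_indicator_one (measurableSet_singleton _).compl,
      probReal_compl_eq_one_sub (measurableSet_singleton _), ← Set.singleton_prod_singleton,
      hQ, measureReal_prod_prod, poissonMeasure_real_singleton, poissonMeasure_real_singleton]
    simp [← Real.exp_add, sub_eq_add_neg]
  have hpos : (0 : ℝ) < r + s := by exact_mod_cast hrs
  rw [e1, e2] at e3
  rw [e1, ← e3]
  field_simp

/-- **Lemma.** If `X, Y` are independent Poisson random variables with means `λ ≥ 0` and `μ ≥ 0`,
`λ + μ > 0`, then for all `a, b ∈ ℕ`:
`E[(a+X)/(b+X+Y) · 1(b+X+Y ≥ 1)] ≤ 2a/(b+1) + (λ/(λ+μ))·(1 − e^{−λ−μ})`. -/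
theorem poisson_ratio_bound
    {Ω : Type*} [MeasurableSpace Ω] (P : Measure Ω) [IsProbabilityMeasure P]
    (X Y : Ω → ℕ) (hX : Measurable X) (hY : Measurable Y)
    (lam mu : ℝ) (hlam : 0 ≤ lam) (hmu : 0 ≤ mu) (hsum : 0 < lam + mu)
    (hXd : ∀ k : ℕ, (P {ω | X ω = k}).toReal = Real.exp (-lam) * lam ^ k / (Nat.factorial k : ℝ))
    (hYd : ∀ k : ℕ, (P {ω | Y ω = k}).toReal = Real.exp (-mu) * mu ^ k / (Nat.factorial k : ℝ))
    (hindep : IndepFun X Y P)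
    (a b : ℕ) :
    ∫ ω, (if 1 ≤ b + X ω + Y ω
        then ((a : ℝ) + X ω) / ((b : ℝ) + X ω + Y ω) else 0) ∂P ≤
      2 * a / (b + 1) + lam / (lam + mu) * (1 - Real.exp (-lam - mu)) := by
  lift lam to NNReal using hlam
  lift mu to NNReal using hmu
  have hlaw : P.map (fun ω => (X ω, Y ω)) =
      (poissonMeasure lam).prod (poissonMeasure mu) := by
    rw [(indepFun_iff_map_prod_eq_prod_map_map hX.aemeasurable hY.aemeasurable).1 hindep,
      law_of Ω P X hX lam hXd, law_of Ω P Y hY mu hYd]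
  have hR := ratio_eq lam mu (by exact_mod_cast hsum)
  rw [← hlaw, integral_map (by fun_prop) (measurable_of_countable _).aestronglyMeasurable] at hR
  have i1 : Integrable (fun ω => (X ω : ℝ) / ((X ω : ℝ) + Y ω)) P := by
    refine Integrable.of_bound (Measurable.aestronglyMeasurable ?_) 1 (.of_forall fun ω => ?_)
    · exact (measurable_of_countable (fun z : ℕ × ℕ => (z.1 : ℝ) / ((z.1 : ℝ) + z.2))).comp
        (hX.prodMk hY)
    · rw [Real.norm_of_nonneg (by positivity)]
      exact div_le_one_of_le₀ (by simp) (by positivity)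
  have key : ∫ ω, (2 * (a : ℝ) / (b + 1) + (X ω : ℝ) / ((X ω : ℝ) + Y ω)) ∂P =
      2 * a / (b + 1) + lam / (lam + mu) * (1 - Real.exp (-lam - mu)) := by
    rw [integral_add (integrable_const _) i1, hR]
    simp
  rw [← key]
  refine integral_mono_of_nonneg (.of_forall fun ω => ?_) ((integrable_const _).add i1)
    (.of_forall fun ω => ?_)
  · dsimp only
    split_ifs
    · simp only [Pi.zero_apply]
      positivity
    · simp
  · dsimp only
    generalize X ω = x
    generalize Y ω = y
    split_ifs with h
    · have hpos : (0 : ℝ) < (b : ℝ) + x + y := by exact_mod_cast h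
      rw [add_div]
      apply add_le_add
      · have : (b : ℝ) + 1 ≤ 2 * (b + x + y) := by
          have : b + 1 ≤ 2 * (b + x + y) := by omega
          exact_mod_cast this
        rw [div_le_div_iff₀ hpos (by positivity)]
        nlinarith [(Nat.cast_nonneg a : (0 : ℝ) ≤ a)]
      · rcases Nat.eq_zero_or_pos x with rfl | hx
        · simp
        · have hx' : (0 : ℝ) < x := by exact_mod_cast hx
          apply div_le_div_of_nonneg_left hx'.le (by positivity)
          have : (0 : ℝ) ≤ b := by positivity
          linarith
    · positivity
end
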